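/- arXiv:1405.5268 — 6 statements merged into one kernel-verified Lean document; each statement's English description precedes it below -/
import Mathlib

section
/- There exists a universal constant c > 0 such that for every ε > 0 there exist arbitrarily large integers N for which there are a monotone Boolean function F : {-1,1}^N → {-1,1} and a Boolean function G : {-1,1}^N → {-1,1} such that G is d-resilient with d ≥ 2^{c·√(log N)/log log N} and Pr_x[F(x) ≠ G(x)] ≤ ε, where x is uniform on {-1,1}^N. -/
open Finset

noncomputable section

/-- The value `±1` of a bit, with `true ↦ 1` and `false ↦ -1`. -/
def sgn (b : Bool) : ℝ := if b then 1 else -1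

/-- Expectation of `f` over a uniformly random point of the hypercube `{-1,1}^ι`. -/
def expect {ι : Type*} [Fintype ι] [DecidableEq ι] (f : (ι → Bool) → ℝ) : ℝ :=
  (∑ x : ι → Bool, f x) / 2 ^ (Fintype.card ι)

/-- Fourier coefficient `ĝ(S) = E[g(x) ∏_{i ∈ S} x_i]`. -/
def fcoef {ι : Type*} [Fintype ι] [DecidableEq ι] (g : (ι → Bool) → ℝ) (S : Finset ι) : ℝ :=
  expect (fun x => g x * ∏ i ∈ S, sgn (x i))

/-- `g` is `d`-resilient if all its Fourier coefficients of degree at most `d` vanish. -/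
def Resilient {ι : Type*} [Fintype ι] [DecidableEq ι] (d : ℕ) (g : (ι → Bool) → ℝ) : Prop :=
  ∀ S : Finset ι, S.card ≤ d → fcoef g S = 0

/-- `f` is Boolean-valued (takes values in `{-1,1}`). -/
def IsBooleanValued {ι : Type*} (f : (ι → Bool) → ℝ) : Prop := ∀ x, f x = 1 ∨ f x = -1

/-- `g` is bounded (takes values in `[-1,1]`). -/
def IsBounded {ι : Type*} (g : (ι → Bool) → ℝ) : Prop := ∀ x, |g x| ≤ 1

/-- `f` is `α`-approximately `d`-resilient: `f` is `α`-close in `ℓ₁` to a bounded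
`d`-resilient function. -/
def ApproxResilient {ι : Type*} [Fintype ι] [DecidableEq ι] (α : ℝ) (d : ℕ)
    (f : (ι → Bool) → ℝ) : Prop :=
  ∃ g : (ι → Bool) → ℝ, Resilient d g ∧ IsBounded g ∧ expect (fun x => |f x - g x|) ≤ α

lemma sgn_eq_one_or (b : Bool) : sgn b = 1 ∨ sgn b = -1 := by cases b <;> simp [sgn]

lemma sgn_mul_self (b : Bool) : sgn b * sgn b = 1 := by cases b <;> simp [sgn]

lemma abs_sgn (b : Bool) : |sgn b| = 1 := by cases b <;> simp [sgn]

lemma sgn_not (b : Bool) : sgn (!b) = -sgn b := by cases b <;> simp [sgn]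

lemma sgn_injective : Function.Injective sgn := by
  intro a b h
  cases a <;> cases b <;> first | rfl | (norm_num [sgn] at h)

lemma sgn_monotone : Monotone sgn := by
  intro a b
  cases a <;> cases b <;> norm_num [sgn]

section Expectation

variable {ι κ β : Type*} [Fintype ι] [DecidableEq ι] [Fintype κ] [DecidableEq κ]
  [Fintype β] [DecidableEq β]

lemma cubeExpect_const (c : ℝ) : expect (fun _ : ι → Bool => c) = c := by
  simp [_root_.expect]

lemma cubeExpect_add (φ ψ : (ι → Bool) → ℝ) :
    expect (fun x => φ x + ψ x) = expect φ + expect ψ := by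
  simp [_root_.expect, sum_add_distrib, add_div]

lemma cubeExpect_sub (φ ψ : (ι → Bool) → ℝ) :
    expect (fun x => φ x - ψ x) = expect φ - expect ψ := by
  simp [_root_.expect, sum_sub_distrib, sub_div]

lemma cubeExpect_const_mul (c : ℝ) (φ : (ι → Bool) → ℝ) :
    expect (fun x => c * φ x) = c * expect φ := by
  simp [_root_.expect, ← mul_sum, mul_div_assoc]

lemma cubeExpect_mono {φ ψ : (ι → Bool) → ℝ} (h : ∀ x, φ x ≤ ψ x) : expect φ ≤ expect ψ := by
  unfold _root_.expect
  gcongr with x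
  exact h x

lemma abs_cubeExpect_le (φ : (ι → Bool) → ℝ) : |expect φ| ≤ expect (fun x => |φ x|) := by
  unfold _root_.expect
  rw [abs_div, abs_of_pos (by positivity : (0 : ℝ) < 2 ^ Fintype.card ι)]
  gcongr
  exact abs_sum_le_sum_abs _ _

lemma cubeExpect_comp_equiv (e : ι ≃ κ) (φ : (ι → Bool) → ℝ) :
    expect (fun x : κ → Bool => φ (x ∘ e)) = expect φ := by
  unfold _root_.expect
  rw [Fintype.card_congr e]
  congr 1
  exact Fintype.sum_equiv (Equiv.arrowCongr e.symm (Equiv.refl Bool)) _ _ fun x => rfl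

lemma cubeExpect_comp_perm (e : (ι → Bool) ≃ (ι → Bool)) (φ : (ι → Bool) → ℝ) :
    expect (fun x => φ (e x)) = expect φ := by
  unfold _root_.expect
  rw [Equiv.sum_comp e φ]

lemma cubeExpect_sum_type (φ : (ι ⊕ κ → Bool) → ℝ) :
    expect φ = expect fun x : ι → Bool => expect fun y : κ → Bool => φ (Sum.elim x y) := by
  unfold _root_.expect
  rw [← sum_div, div_div, Fintype.card_sum, pow_add, mul_comm ((2 : ℝ) ^ _)]
  congr 1
  rw [← Fintype.sum_prod_type']
  exact Fintype.sum_equiv (Equiv.sumArrowEquivProdArrow ι κ Bool) _ _ fun x => by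
    congr 1
    exact (Sum.elim_comp_inl_inr x).symm

/-- A function of independent blocks, seen through one bit of each block. -/
lemma cubeExpect_blocks (h : β → (ι → Bool) → Bool) (w : β → (ι → Bool) → ℝ) (Φ : (β → Bool) → ℝ) :
    expect (fun x : β × ι → Bool =>
        Φ (fun b => h b fun i => x (b, i)) * ∏ b, w b fun i => x (b, i)) =
      ∑ y, Φ y * ∏ b, expect fun z => if h b z = y b then w b z else 0 := by
  have hsum : ∑ X : β → ι → Bool, Φ (fun b => h b (X b)) * ∏ b, w b (X b) =
      ∑ y, Φ y * ∏ b, ∑ z, if h b z = y b then w b z else 0 := by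
    rw [← sum_fiberwise_of_maps_to (s := univ) (t := univ)
      (g := fun (X : β → ι → Bool) b => h b (X b)) (fun _ _ => mem_univ _)]
    refine sum_congr rfl fun y _ => ?_
    simp_rw [← sum_filter]
    rw [prod_univ_sum, mul_sum]
    refine sum_congr ?_ fun X hX => ?_
    · ext X
      simp [funext_iff]
    · have : (fun b => h b (X b)) = y := funext fun b => by
        simpa using (Fintype.mem_piFinset.1 hX) b
      rw [this]
  unfold _root_.expect
  simp_rw [prod_div_distrib, ← mul_div_assoc, ← sum_div, prod_const, card_univ, ← pow_mul]
  rw [Fintype.card_prod, mul_comm (Fintype.card β), ← hsum]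
  congr 1
  exact Fintype.sum_equiv (Equiv.curry β ι Bool) _ _ fun x => rfl

lemma Resilient.expect_eq_zero {d : ℕ} {g : (ι → Bool) → ℝ} (hg : Resilient d g) :
    expect g = 0 := by
  simpa [fcoef] using hg ∅ (by simp)

lemma prod_sgn_blocks (S : Finset (β × ι)) (x : β × ι → Bool) :
    ∏ p ∈ S, sgn (x p) = ∏ b, ∏ i with (b, i) ∈ S, sgn (x (b, i)) := by
  simp_rw [prod_filter]
  rw [← Fintype.prod_prod_type' (fun b i => if (b, i) ∈ S then sgn (x (b, i)) else 1)]
  simp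

lemma cubeExpect_ite_eq (h : (ι → Bool) → Bool) (w : (ι → Bool) → ℝ) (c : Bool) :
    expect (fun z => if h z = c then w z else 0) =
      sgn c * (expect (fun z => sgn (h z) * w z) / 2) + expect w / 2 := by
  have : (fun z => if h z = c then w z else 0) =
      fun z => (sgn c / 2) * (sgn (h z) * w z) + (1 / 2) * w z := by
    funext z
    cases h z <;> cases c <;> simp [sgn] <;> ring
  rw [this, cubeExpect_add, cubeExpect_const_mul, cubeExpect_const_mul]
  ring

/-- Block composition multiplies the orders of resilience (shifted by one). -/
lemma Resilient.comp_blocks {d e m : ℕ} {g : (β → Bool) → Bool} {h : (ι → Bool) → Bool}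
    (hg : Resilient d fun x => sgn (g x)) (hh : Resilient e fun x => sgn (h x))
    (hm : m < (d + 1) * (e + 1)) :
    Resilient m fun x : β × ι → Bool => sgn (g fun b => h fun i => x (b, i)) := by
  intro S hS
  unfold fcoef
  simp_rw [prod_sgn_blocks]
  rw [cubeExpect_blocks (fun _ => h) (fun b z => ∏ i with (b, i) ∈ S, sgn (z i)) (fun y => sgn (g y))]
  simp_rw [cubeExpect_ite_eq, prod_add, mul_sum]
  rw [sum_comm]
  refine sum_eq_zero fun T _ => ?_
  simp_rw [prod_mul_distrib]
  by_cases hT : T.card ≤ d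
  · have h0 := hg T hT
    unfold fcoef _root_.expect at h0
    rw [div_eq_zero_iff, or_iff_left (by positivity)] at h0
    simp_rw [← mul_assoc, ← sum_mul]
    rw [h0]
    simp
  · obtain ⟨b, hbT, hb⟩ : ∃ b ∈ T, (univ.filter fun i => (b, i) ∈ S).card ≤ e := by
      by_contra! hcon
      have h1 : T.card * (e + 1) ≤ ∑ b ∈ T, (univ.filter fun i => (b, i) ∈ S).card := by
        rw [← smul_eq_mul]
        exact card_nsmul_le_sum _ _ _ fun b hb => hcon b hb
      have h2 : ∑ b ∈ T, (univ.filter fun i => (b, i) ∈ S).card ≤ S.card := by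
        calc _ ≤ ∑ b, (univ.filter fun i => (b, i) ∈ S).card :=
              sum_le_sum_of_subset (subset_univ T)
          _ = S.card := by
              simp_rw [card_filter]
              rw [← Fintype.sum_prod_type' (fun b i => if (b, i) ∈ S then 1 else 0)]
              simp
      have h3 : (d + 1) * (e + 1) ≤ T.card * (e + 1) := Nat.mul_le_mul_right _ (by omega)
      omega
    refine sum_eq_zero fun y _ => ?_
    have h0 := hh _ hb
    unfold fcoef at h0
    rw [prod_eq_zero (s := T) (i := b) (f := fun b => _ / (2 : ℝ)) hbT (by simp only [h0, zero_div])]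
    simp

end Expectation

section Composition

variable {ι β : Type*} [Fintype ι] [DecidableEq ι] [Fintype β] [DecidableEq β]

/-- The probability that `F` and `G` disagree at a uniformly random point. -/
def disagreement (F G : (ι → Bool) → Bool) : ℝ :=
  expect fun x => if F x = G x then (0 : ℝ) else 1

/-- The probability that coordinate `b` is pivotal for `f`. -/
def influence (f : (β → Bool) → Bool) (b : β) : ℝ :=
  disagreement (fun x => f (Function.update x b true)) fun x => f (Function.update x b false)

lemma disagreement_triangle (F G H : (ι → Bool) → Bool) :
    disagreement F H ≤ disagreement F G + disagreement G H := by
  unfold disagreement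
  rw [← cubeExpect_add]
  refine cubeExpect_mono fun x => ?_
  cases F x <;> cases G x <;> cases H x <;> norm_num

lemma disagreement_nonneg (F G : (ι → Bool) → Bool) : 0 ≤ disagreement F G := by
  unfold disagreement
  refine (cubeExpect_const (ι := ι) 0).ge.trans (cubeExpect_mono fun x => ?_)
  split_ifs <;> norm_num

lemma disagreement_self (F : (ι → Bool) → Bool) : disagreement F F = 0 := by
  simp [disagreement, cubeExpect_const]

/-- Balanced independent blocks produce uniformly random bits. -/
lemma cubeExpect_comp_balanced (h : β → (ι → Bool) → Bool)
    (hh : ∀ b, expect (fun z => sgn (h b z)) = 0) (Φ : (β → Bool) → ℝ) :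
    expect (fun x : β × ι → Bool => Φ fun b => h b fun i => x (b, i)) = expect Φ := by
  have key := cubeExpect_blocks h (fun _ _ => 1) Φ
  simp only [prod_const_one, mul_one] at key
  rw [key]
  simp_rw [cubeExpect_ite_eq, mul_one, hh, cubeExpect_const]
  simp [_root_.expect, sum_mul, div_eq_mul_inv]

lemma disagreement_hybrid_step (f : (β → Bool) → Bool) {F G : (ι → Bool) → Bool}
    (hF : expect (fun z => sgn (F z)) = 0) (hG : expect (fun z => sgn (G z)) = 0)
    (s : Finset β) (b : β) (hb : b ∉ s) :
    disagreement
        (fun x : β × ι → Bool => f fun a =>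
          if a ∈ insert b s then F fun i => x (a, i) else G fun i => x (a, i))
        (fun x : β × ι → Bool => f fun a =>
          if a ∈ s then F fun i => x (a, i) else G fun i => x (a, i)) ≤
      disagreement F G * influence f b := by
  set h : β → (ι → Bool) → Bool := fun a => if a ∈ s then F else G with hh
  have hbal : ∀ a, expect (fun z => sgn (h a z)) = 0 := by
    intro a
    by_cases ha : a ∈ s <;> simp [hh, ha, hF, hG]
  let w : β → (ι → Bool) → ℝ := fun a z => if a = b then (if F z = G z then 0 else 1) else 1
  let Φ : (β → Bool) → ℝ := fun y =>
    if f (Function.update y b true) = f (Function.update y b false) then 0 else 1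
  have hfac : ∀ a c, expect (fun z => if h a z = c then w a z else 0) =
      (if a = b then disagreement F G else 1) / 2 := by
    intro a c
    rw [cubeExpect_ite_eq]
    by_cases hab : a = b
    · subst hab
      have h1 : (fun z => sgn (h a z) * w a z) =
          fun z => (1 / 2) * (sgn (G z) - sgn (F z)) := by
        funext z
        simp only [hh, hb, w, if_true, if_false]
        cases F z <;> cases G z <;> norm_num [sgn]
      rw [h1, cubeExpect_const_mul, cubeExpect_sub, hF, hG]
      simp [w, disagreement]
    · simp [w, hab, hbal, cubeExpect_const]
  calc _ ≤ expect (fun x : β × ι → Bool =>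
        Φ (fun a => h a fun i => x (a, i)) * ∏ a, w a fun i => x (a, i)) := by
        unfold disagreement
        refine cubeExpect_mono fun x => ?_
        have hw : ∏ a, w a (fun i => x (a, i)) =
            if F (fun i => x (b, i)) = G (fun i => x (b, i)) then 0 else 1 := by
          simp [w]
        rw [hw]
        set y : β → Bool := fun a => h a fun i => x (a, i) with hy
        have e1 : (fun a => if a ∈ s then F fun i => x (a, i) else G fun i => x (a, i)) = y := by
          funext a
          by_cases ha : a ∈ s <;> simp [hy, hh, ha]
        have e2 : (fun a => if a ∈ insert b s then F fun i => x (a, i) else G fun i => x (a, i)) =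
            Function.update y b (F fun i => x (b, i)) := by
          funext a
          by_cases hab : a = b
          · subst hab
            simp
          · by_cases ha : a ∈ s <;> simp [hy, hh, ha, hab]
        have e3 : y = Function.update y b (G fun i => x (b, i)) := by
          have : (G fun i => x (b, i)) = y b := by simp [hy, hh, hb]
          rw [this, Function.update_eq_self]
        have e4 := congrArg f e3
        simp only [Φ, e1, e2, e4]
        generalize F (fun i => x (b, i)) = p
        generalize G (fun i => x (b, i)) = q
        cases p <;> cases q <;> simp [eq_comm]
    _ = disagreement F G * influence f b := by
        rw [cubeExpect_blocks]
        simp_rw [hfac, prod_div_distrib]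
        rw [← sum_mul]
        simp only [prod_ite_eq', mem_univ, if_true, prod_const, card_univ]
        unfold influence
        conv_rhs => rw [disagreement]
        simp only [Φ, _root_.expect, disagreement]
        ring

/-- Replacing each input bit of `f` by a noisy copy changes `f` with probability at most the noise
rate times the total influence. -/
lemma disagreement_comp_le (f : (β → Bool) → Bool) {F G : (ι → Bool) → Bool}
    (hF : expect (fun z => sgn (F z)) = 0) (hG : expect (fun z => sgn (G z)) = 0) :
    disagreement (fun x : β × ι → Bool => f fun b => F fun i => x (b, i))
        (fun x : β × ι → Bool => f fun b => G fun i => x (b, i)) ≤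
      disagreement F G * ∑ b, influence f b := by
  have key : ∀ s : Finset β, disagreement
      (fun x : β × ι → Bool => f fun a =>
          if a ∈ s then F fun i => x (a, i) else G fun i => x (a, i))
      (fun x : β × ι → Bool => f fun b => G fun i => x (b, i)) ≤
        disagreement F G * ∑ b ∈ s, influence f b := by
    intro s
    induction s using Finset.induction_on with
    | empty => simp [disagreement_self]
    | insert b s hb ih =>
      rw [sum_insert hb, mul_add]
      exact (disagreement_triangle _ _ _).trans
        (add_le_add (disagreement_hybrid_step f hF hG s b hb) ih)
  simpa using key univ

/-- `F` is monotone and balanced, and disagrees with the `d`-resilient function `G` with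
probability at most `δ`. -/
structure ResilientPair (d : ℕ) (δ : ℝ) (F G : (ι → Bool) → Bool) : Prop where
  monotone : Monotone F
  balanced : expect (fun x => sgn (F x)) = 0
  resilient : Resilient d fun x => sgn (G x)
  disagreement_le : disagreement F G ≤ δ

lemma ResilientPair.comp_blocks {d e m : ℕ} {α δ : ℝ} {f g : (β → Bool) → Bool}
    {F G : (ι → Bool) → Bool} (hfg : ResilientPair d α f g) (hFG : ResilientPair e δ F G)
    (hm : m < (d + 1) * (e + 1)) :
    ResilientPair m (α + δ * ∑ b, influence f b)
      (fun x : β × ι → Bool => f fun b => F fun i => x (b, i))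
      (fun x : β × ι → Bool => g fun b => G fun i => x (b, i)) where
  monotone x y hxy := hfg.monotone fun b => hFG.monotone fun i => hxy (b, i)
  balanced := by
    rw [cubeExpect_comp_balanced (fun _ => F) (fun _ => hFG.balanced) fun y => sgn (f y)]
    exact hfg.balanced
  resilient := hfg.resilient.comp_blocks hFG.resilient hm
  disagreement_le := by
    have hG := hFG.resilient.expect_eq_zero
    have h1 := disagreement_triangle
      (fun x : β × ι → Bool => f fun b => F fun i => x (b, i))
      (fun x : β × ι → Bool => f fun b => G fun i => x (b, i))
      (fun x : β × ι → Bool => g fun b => G fun i => x (b, i))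
    have h2 := disagreement_comp_le f hFG.balanced hG
    have h3 : disagreement (fun x : β × ι → Bool => f fun b => G fun i => x (b, i))
        (fun x : β × ι → Bool => g fun b => G fun i => x (b, i)) = disagreement f g :=
      cubeExpect_comp_balanced (fun _ => G) (fun _ => hG) fun y => if f y = g y then 0 else 1
    have h4 : disagreement F G * ∑ b, influence f b ≤ δ * ∑ b, influence f b :=
      mul_le_mul_of_nonneg_right hFG.disagreement_le
        (sum_nonneg fun b _ => disagreement_nonneg _ _)
    linarith [hfg.disagreement_le]

lemma ResilientPair.comp_equiv {d : ℕ} {δ : ℝ} {F G : (ι → Bool) → Bool}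
    (h : ResilientPair d δ F G) (e : ι ≃ β) :
    ResilientPair d δ (fun x : β → Bool => F (x ∘ e)) fun x : β → Bool => G (x ∘ e) where
  monotone x y hxy := h.monotone fun i => hxy (e i)
  balanced := (cubeExpect_comp_equiv e fun x => sgn (F x)).trans h.balanced
  resilient S hS := by
    have h0 := h.resilient (S.map e.symm.toEmbedding) (by simpa using hS)
    unfold fcoef at h0 ⊢
    rw [← h0, ← cubeExpect_comp_equiv e]
    simp
  disagreement_le :=
    (cubeExpect_comp_equiv e fun x => if F x = G x then (0 : ℝ) else 1).le.trans h.disagreement_le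

lemma cubeExpect_sgn_apply (i : ι) : expect (fun x : ι → Bool => sgn (x i)) = 0 := by
  have h := cubeExpect_comp_perm (Equiv.arrowCongr (Equiv.refl ι) Equiv.boolNot)
    fun x : ι → Bool => sgn (x i)
  have h2 : (fun x : ι → Bool => sgn ((Equiv.arrowCongr (Equiv.refl ι) Equiv.boolNot) x i)) =
      fun x => (-1) * sgn (x i) := by
    funext x
    simp [Equiv.arrowCongr, sgn_not]
  rw [h2, cubeExpect_const_mul] at h
  linarith

/-- Iterated block composition of a `1`-resilient pair. -/
lemma ResilientPair.iterate {α J : ℝ} {f g : (β → Bool) → Bool} (hfg : ResilientPair 1 α f g)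
    (hJ : 1 + ∑ b, influence f b ≤ J) (k : ℕ) :
    ∃ F G : (Fin (Fintype.card β ^ k) → Bool) → Bool,
      ResilientPair (2 ^ k - 1) (α * J ^ k) F G := by
  have hα : 0 ≤ α := (disagreement_nonneg f g).trans hfg.disagreement_le
  have hI : 0 ≤ ∑ b, influence f b := sum_nonneg fun b _ => disagreement_nonneg _ _
  induction k with
  | zero =>
    have h0 : ResilientPair 0 (α * J ^ 0) (fun x : Unit → Bool => x ()) fun x => x () := by
      refine ⟨fun x y hxy => hxy (), cubeExpect_sgn_apply (), fun S hS => ?_, ?_⟩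
      · rw [Nat.le_zero, card_eq_zero] at hS
        simpa [hS, fcoef] using cubeExpect_sgn_apply ()
      · rw [disagreement_self]
        simpa using hα
    exact ⟨_, _, h0.comp_equiv (Fintype.equivFinOfCardEq (by simp))⟩
  | succ k ih =>
    obtain ⟨F, G, hFG⟩ := ih
    have hk : 1 ≤ 2 ^ k := Nat.one_le_two_pow
    have h1 := hfg.comp_blocks hFG (m := 2 ^ (k + 1) - 1) (by rw [pow_succ]; omega)
    have h2 := h1.comp_equiv (Fintype.equivFinOfCardEq (n := Fintype.card β ^ (k + 1))
      (by simp [pow_succ, mul_comm]))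
    refine ⟨_, _, h2.monotone, h2.balanced, h2.resilient, h2.disagreement_le.trans ?_⟩
    have hJk : 1 ≤ J ^ k := one_le_pow₀ (by linarith)
    have h3 : α * 1 ≤ α * J ^ k := mul_le_mul_of_nonneg_left hJk hα
    have h4 : 0 ≤ α * J ^ k := by linarith
    have h5 : α * J ^ k * (1 + ∑ b, influence f b) ≤ α * J ^ k * J :=
      mul_le_mul_of_nonneg_left hJ h4
    rw [pow_succ]
    linarith

end Composition

section Rounding

variable {β : Type*} [Fintype β] [DecidableEq β]

lemma cubeExpect_eq_update (φ : (β → Bool) → ℝ) (b : β) :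
    expect φ = expect fun x =>
      (1 / 2) * (φ (Function.update x b true) + φ (Function.update x b false)) := by
  have hinv : Function.Involutive fun x : β → Bool => Function.update x b (!x b) := by
    intro x
    simp
  have h := cubeExpect_comp_perm (hinv.toPerm _) φ
  have hsum : (fun x => φ (Function.update x b true) + φ (Function.update x b false)) =
      fun x => φ x + φ (hinv.toPerm _ x) := by
    funext x
    simp only [Function.Involutive.coe_toPerm]
    cases hx : x b
    · rw [← hx, Function.update_eq_self, hx, Bool.not_false, add_comm]
    · rw [← hx, Function.update_eq_self, hx, Bool.not_true]
  rw [cubeExpect_const_mul, hsum, cubeExpect_add, h]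
  ring

lemma abs_degree_one_coeff_le (f : (β → Bool) → Bool) (b : β) :
    |expect fun x => sgn (f x) * sgn (x b)| ≤ influence f b := by
  rw [cubeExpect_eq_update _ b]
  refine (abs_cubeExpect_le _).trans (cubeExpect_mono fun x => ?_)
  simp only [Function.update_self]
  beta_reduce
  cases f (Function.update x b true) <;> cases f (Function.update x b false) <;>
    norm_num [sgn]

/-- The imaginary part of a Riesz product with purely imaginary coefficients. -/
def rieszIm (c : β → ℝ) (x : β → Bool) : ℝ :=
  (∏ j, (1 + ((c j * sgn (x j) : ℝ) : ℂ) * Complex.I)).im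

lemma sum_cube_prod (φ : β → Bool → ℂ) :
    ∑ x : β → Bool, ∏ j, φ j (x j) = ∏ j, (φ j true + φ j false) := by
  have h := prod_univ_sum (fun _ : β => (univ : Finset Bool)) φ
  rw [Fintype.piFinset_univ] at h
  rw [← h]
  simp

lemma cubeExpect_rieszIm (c : β → ℝ) : expect (rieszIm c) = 0 := by
  unfold _root_.expect rieszIm
  rw [← Complex.im_sum, sum_cube_prod fun j s => 1 + ((c j * sgn s : ℝ) : ℂ) * Complex.I]
  have h : ∀ j, (1 + ((c j * sgn true : ℝ) : ℂ) * Complex.I) +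
      (1 + ((c j * sgn false : ℝ) : ℂ) * Complex.I) = ((2 : ℝ) : ℂ) := by
    intro j
    simp [sgn]
    ring
  simp_rw [h]
  rw [← Complex.ofReal_prod, Complex.ofReal_im, zero_div]

lemma cubeExpect_rieszIm_mul_sgn (c : β → ℝ) (b : β) :
    expect (fun x => rieszIm c x * sgn (x b)) = c b := by
  unfold _root_.expect rieszIm
  simp_rw [← Complex.im_mul_ofReal]
  have h0 : ∀ x : β → Bool,
      (∏ j, (1 + ((c j * sgn (x j) : ℝ) : ℂ) * Complex.I)) * ((sgn (x b) : ℝ) : ℂ) =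
      ∏ j, ((1 + ((c j * sgn (x j) : ℝ) : ℂ) * Complex.I) *
        if j = b then ((sgn (x j) : ℝ) : ℂ) else 1) := by
    intro x
    rw [prod_mul_distrib]
    simp
  simp_rw [h0]
  rw [← Complex.im_sum, sum_cube_prod fun j s => (1 + ((c j * sgn s : ℝ) : ℂ) * Complex.I) *
        if j = b then ((sgn s : ℝ) : ℂ) else 1]
  have h : ∀ j, ((1 + ((c j * sgn true : ℝ) : ℂ) * Complex.I) *
        if j = b then ((sgn true : ℝ) : ℂ) else 1) +
      ((1 + ((c j * sgn false : ℝ) : ℂ) * Complex.I) *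
        if j = b then ((sgn false : ℝ) : ℂ) else 1) =
      ((2 : ℝ) : ℂ) * if j = b then ((c b : ℝ) : ℂ) * Complex.I else 1 := by
    intro j
    split_ifs with hj
    · subst hj
      simp [sgn]
      ring
    · simp [sgn]
      ring
  simp_rw [h, prod_mul_distrib]
  simp only [prod_const, card_univ, prod_ite_eq', mem_univ, if_true]
  rw [← Complex.ofReal_pow, Complex.im_ofReal_mul]
  simp

omit [DecidableEq β] in
lemma abs_rieszIm_le (c : β → ℝ) (hc : ∑ j, c j ^ 2 ≤ 1) (x : β → Bool) :
    |rieszIm c x| ≤ 2 := by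
  refine (Complex.abs_im_le_norm _).trans ?_
  have h : ‖∏ j, (1 + ((c j * sgn (x j) : ℝ) : ℂ) * Complex.I)‖ ^ 2 ≤ 2 ^ 2 := by
    rw [norm_prod, ← prod_pow]
    have hj : ∀ j, ‖1 + ((c j * sgn (x j) : ℝ) : ℂ) * Complex.I‖ ^ 2 = c j ^ 2 + 1 := by
      intro j
      rw [← Complex.normSq_eq_norm_sq]
      have := sgn_mul_self (x j)
      simp only [Complex.normSq_apply, Complex.add_re, Complex.one_re, Complex.re_ofReal_mul,
        Complex.I_re, Complex.add_im, Complex.one_im, Complex.im_ofReal_mul, Complex.I_im]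
      linear_combination c j ^ 2 * this
    simp_rw [hj]
    calc ∏ j, (c j ^ 2 + 1) ≤ ∏ j, Real.exp (c j ^ 2) :=
          prod_le_prod (fun j _ => by positivity) fun j _ => Real.add_one_le_exp _
      _ = Real.exp (∑ j, c j ^ 2) := (Real.exp_sum _ _).symm
      _ ≤ Real.exp 1 := Real.exp_le_exp.2 hc
      _ ≤ 2 ^ 2 := by linarith [Real.exp_one_lt_d9]
  exact (sq_le_sq₀ (norm_nonneg _) (by norm_num)).1 h

lemma exists_int_sgn (b : Bool) : ∃ z : ℤ, sgn b = z := by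
  cases b
  · exact ⟨-1, by simp [sgn]⟩
  · exact ⟨1, by simp [sgn]⟩

lemma exists_int_rieszIm (c : β → ℝ) (D : ℕ) (hc : ∀ j, ∃ z : ℤ, c j * D = z) (x : β → Bool) :
    ∃ z : ℤ, rieszIm c x * D ^ Fintype.card β = z := by
  have h : ∀ s : Finset β, ∃ p q : ℤ,
      (∏ j ∈ s, (1 + ((c j * sgn (x j) : ℝ) : ℂ) * Complex.I)) * (((D : ℝ) ^ #s : ℝ) : ℂ) =
        ((p : ℝ) : ℂ) + ((q : ℝ) : ℂ) * Complex.I := by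
    intro s
    induction s using Finset.induction_on with
    | empty => exact ⟨1, 0, by simp⟩
    | insert a s ha ih =>
      obtain ⟨p, q, hpq⟩ := ih
      obtain ⟨z, hz⟩ := hc a
      obtain ⟨σ, hσ⟩ := exists_int_sgn (x a)
      refine ⟨p * D - q * (z * σ), q * D + p * (z * σ), ?_⟩
      rw [prod_insert ha, card_insert_of_notMem ha, pow_succ, hσ]
      push_cast at hpq ⊢
      have hz' : (c a : ℂ) * D = z := by exact_mod_cast hz
      rw [← hz']
      linear_combination (D * (1 + c a * σ * Complex.I)) * hpq +
        (q * (c a * D * σ)) * Complex.I_sq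
  obtain ⟨p, q, hpq⟩ := h univ
  refine ⟨q, ?_⟩
  have h2 := congrArg Complex.im hpq
  rw [Complex.im_mul_ofReal, card_univ] at h2
  simpa [rieszIm] using h2

lemma exists_bool_cubeExpect_eq {c : ℝ} (hc : |c| ≤ 1)
    (z : ℤ) (hz : (1 + c) / 2 * 2 ^ Fintype.card β = z) :
    ∃ B : (β → Bool) → Bool, expect (fun u => sgn (B u)) = c := by
  rw [abs_le] at hc
  have hpos : (0 : ℝ) < 2 ^ Fintype.card β := by positivity
  have hz0 : 0 ≤ z := by
    have : (0 : ℝ) ≤ z := by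
      rw [← hz]
      exact mul_nonneg (by linarith) hpos.le
    exact_mod_cast this
  obtain ⟨m, rfl⟩ := Int.eq_ofNat_of_zero_le hz0
  have hm : m ≤ #(univ : Finset (β → Bool)) := by
    have : (m : ℝ) ≤ 2 ^ Fintype.card β := by
      calc (m : ℝ) = (1 + c) / 2 * 2 ^ Fintype.card β := by rw [hz]; simp
        _ ≤ 1 * 2 ^ Fintype.card β := by gcongr; linarith
        _ = _ := one_mul _
    rw [card_univ, Fintype.card_fun, Fintype.card_bool]
    exact_mod_cast this
  obtain ⟨S, -, hS⟩ := exists_subset_card_eq hm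
  refine ⟨fun u => decide (u ∈ S), ?_⟩
  have h1 : ∀ u, sgn (decide (u ∈ S)) = 2 * (if u ∈ S then (1 : ℝ) else 0) - 1 := by
    intro u
    by_cases hu : u ∈ S
    · norm_num [sgn, hu]
    · norm_num [sgn, hu]
  unfold _root_.expect
  simp_rw [h1]
  rw [sum_sub_distrib, ← mul_sum]
  simp only [sum_ite_mem, univ_inter, sum_const, hS, card_univ, Fintype.card_fun,
    Fintype.card_bool, nsmul_eq_mul, mul_one]
  rw [div_eq_iff hpos.ne']
  push_cast at hz ⊢
  linarith

lemma cubeExpect_xor {ρ : Type*} [Fintype ρ] [DecidableEq ρ] (φ : (ρ → Bool) → ℝ) :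
    expect (fun y : ρ ⊕ ρ → Bool => φ fun i => xor (y (.inl i)) (y (.inr i))) = expect φ := by
  rw [cubeExpect_sum_type]
  have h : ∀ s : ρ → Bool, expect (fun t : ρ → Bool => φ fun i => xor (s i) (t i)) = expect φ := by
    intro s
    have hinv : Function.Involutive fun (t : ρ → Bool) i => xor (s i) (t i) := by
      intro t
      funext i
      simp
    exact cubeExpect_comp_perm (hinv.toPerm _) φ
  simp [h, cubeExpect_const]

lemma ite_eq_half_sub_sgn (a b : Bool) :
    (if a = b then (0 : ℝ) else 1) = 1 / 2 - (1 / 2) * (sgn b * sgn a) := by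
  cases a <;> cases b <;> norm_num [sgn]

/-- A bounded function with vanishing low-degree part is realized, after adding uniform dummy bits,
by a `1`-resilient Boolean function. -/
lemma exists_rounding {f : (β → Bool) → Bool} {g : (β → Bool) → ℝ} {r : ℕ} {δ : ℝ}
    (hmono : Monotone f) (hbal : expect (fun x => sgn (f x)) = 0)
    (hg : ∀ x, |g x| ≤ 1) (hint : ∀ x, ∃ z : ℤ, (1 + g x) / 2 * 2 ^ r = z)
    (hg0 : expect g = 0) (hg1 : ∀ b, expect (fun x => g x * sgn (x b)) = 0)
    (hδ : 1 - 2 * δ ≤ expect fun x => g x * sgn (f x)) :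
    ∃ G : (β ⊕ (Fin r ⊕ Fin r) → Bool) → Bool,
      ResilientPair 1 δ (fun x : β ⊕ (Fin r ⊕ Fin r) → Bool => f (x ∘ Sum.inl)) G := by
  have hB : ∀ x, ∃ B : (Fin r → Bool) → Bool, expect (fun u => sgn (B u)) = g x := by
    intro x
    obtain ⟨z, hz⟩ := hint x
    exact exists_bool_cubeExpect_eq (hg x) z (by simpa using hz)
  choose B hB using hB
  let G : (β ⊕ (Fin r ⊕ Fin r) → Bool) → Bool := fun x =>
    B (x ∘ Sum.inl) fun i => xor (x (.inr (.inl i))) (x (.inr (.inr i)))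
  have hG : ∀ φ : (β → Bool) → ℝ, expect (fun x => sgn (G x) * φ (x ∘ Sum.inl)) =
      expect fun x => g x * φ x := by
    intro φ
    rw [cubeExpect_sum_type]
    congr 1
    funext x
    simp only [G, Sum.elim_comp_inl, Sum.elim_inr]
    rw [cubeExpect_xor fun u => sgn (B x u) * φ x]
    simp_rw [mul_comm _ (φ x)]
    rw [cubeExpect_const_mul, hB]
  refine ⟨G, fun x y hxy => hmono fun b => hxy (.inl b), ?_, fun S hS => ?_, ?_⟩
  · rw [cubeExpect_sum_type]
    simp [cubeExpect_const, hbal]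
  · rcases Nat.le_one_iff_eq_zero_or_eq_one.1 hS with h | h
    · rw [card_eq_zero] at h
      subst h
      simpa [fcoef, hg0] using hG fun _ => 1
    · obtain ⟨i, rfl⟩ := card_eq_one.1 h
      simp only [fcoef, prod_singleton]
      rcases i with b | k
      · exact (hG fun x => sgn (x b)).trans (hg1 b)
      · have hinv : Function.Involutive fun x : β ⊕ (Fin r ⊕ Fin r) → Bool =>
            Sum.elim (x ∘ Sum.inl) fun k => !x (.inr k) := by
          intro x
          funext i
          rcases i with b | k <;> simp
        have h1 := cubeExpect_comp_perm (hinv.toPerm _) fun x => sgn (G x) * sgn (x (.inr k))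
        have h2 : (fun x => sgn (G (hinv.toPerm _ x)) * sgn (hinv.toPerm _ x (.inr k))) =
            fun x => (-1) * (sgn (G x) * sgn (x (.inr k))) := by
          funext x
          have : G (hinv.toPerm _ x) = G x := by
            simp [G]
          rw [this]
          simp [sgn_not]
        rw [h2, cubeExpect_const_mul] at h1
        linarith
  · unfold disagreement
    simp_rw [ite_eq_half_sub_sgn]
    rw [cubeExpect_sub, cubeExpect_const_mul, cubeExpect_const,
      hG fun x => sgn (f x)]
    linarith

lemma influence_comp_inl {κ : Type*} [Fintype κ] [DecidableEq κ] (f : (β → Bool) → Bool) (b : β) :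
    influence (fun x : β ⊕ κ → Bool => f (x ∘ Sum.inl)) (.inl b) = influence f b := by
  unfold influence disagreement
  rw [cubeExpect_sum_type]
  simp only [Sum.update_inl_comp_inl, Sum.elim_comp_inl, cubeExpect_const]

lemma influence_comp_inr {κ : Type*} [Fintype κ] [DecidableEq κ] (f : (β → Bool) → Bool) (k : κ) :
    influence (fun x : β ⊕ κ → Bool => f (x ∘ Sum.inl)) (.inr k) = 0 := by
  unfold influence
  simp [disagreement_self]

/-- A balanced monotone function with small influences is close to a `1`-resilient Boolean
function, after adding dummy variables. -/
lemma exists_oneResilient_pair {f : (β → Bool) → Bool} (v : ℕ)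
    (hmono : Monotone f) (hbal : expect (fun x => sgn (f x)) = 0)
    (hinf : ∑ b, influence f b ^ 2 ≤ (1 / 2 ^ (v + 1)) ^ 2) :
    ∃ (r : ℕ) (F G : (β ⊕ (Fin r ⊕ Fin r) → Bool) → Bool),
      r = Fintype.card β ^ 2 + 2 * v + 2 ∧ ResilientPair 1 (1 / 2 ^ v) F G ∧
      ∑ i, influence F i = ∑ b, influence f b := by
  set n := Fintype.card β with hn
  set a : β → ℝ := fun b => expect fun x => sgn (f x) * sgn (x b) with ha
  set c : β → ℝ := fun b => 2 ^ (v + 1) * a b with hc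
  set η : ℝ := 1 / 2 ^ v with hη
  have hη0 : 0 < η := by positivity
  have hη1 : η ≤ 1 := by
    rw [hη, div_le_one (by positivity)]
    exact one_le_pow₀ (by norm_num)
  have hη2 : η * 2 ^ v = 1 := by
    rw [hη]
    field_simp
  have hc1 : ∑ j, c j ^ 2 ≤ 1 := by
    have h1 : ∑ j, c j ^ 2 ≤ (2 ^ (v + 1)) ^ 2 * ∑ b, influence f b ^ 2 := by
      rw [mul_sum]
      refine sum_le_sum fun b _ => ?_
      rw [hc, mul_pow, ← sq_abs (a b)]
      gcongr
      exact abs_degree_one_coeff_le f b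
    refine h1.trans ((mul_le_mul_of_nonneg_left hinf (by positivity)).trans_eq ?_)
    field_simp
  have hcint : ∀ j, ∃ z : ℤ, c j * (2 ^ n : ℕ) = z := by
    intro j
    choose s hs using exists_int_sgn
    refine ⟨2 ^ (v + 1) * ∑ x : β → Bool, s (f x) * s (x j), ?_⟩
    simp only [hc, ha, _root_.expect, hs, ← hn]
    push_cast
    field_simp
  set p : (β → Bool) → ℝ := fun x => η / 2 * rieszIm c x with hp
  have hpb : ∀ x, |p x| ≤ η := by
    intro x
    have := abs_rieszIm_le c hc1 x
    rw [hp, abs_mul, abs_of_pos (by positivity)]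
    nlinarith
  set g : (β → Bool) → ℝ := fun x => (1 - η) * (sgn (f x) - p x) with hg
  have hgb : ∀ x, |g x| ≤ 1 := by
    intro x
    have h1 := abs_sub (sgn (f x)) (p x)
    rw [abs_sgn] at h1
    rw [hg, abs_mul, abs_of_nonneg (by linarith)]
    nlinarith [hpb x]
  suffices h : ∃ G : (β ⊕ (Fin (n ^ 2 + 2 * v + 2) ⊕ Fin (n ^ 2 + 2 * v + 2)) → Bool) → Bool,
      ResilientPair 1 η (fun x => f (x ∘ Sum.inl)) G by
    obtain ⟨G, hG⟩ := h
    refine ⟨_, _, G, rfl, hG, ?_⟩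
    rw [Fintype.sum_sum_type]
    simp [influence_comp_inl, influence_comp_inr]
  refine exists_rounding hmono hbal hgb ?_ ?_ ?_ ?_
  · intro x
    obtain ⟨z, hz⟩ := exists_int_rieszIm c (2 ^ n) hcint x
    obtain ⟨s, hs⟩ := exists_int_sgn (f x)
    refine ⟨2 ^ (n ^ 2 + 2 * v + 1) + (2 ^ v - 1) * (2 * 2 ^ v * 2 ^ (n ^ 2) * s - z), ?_⟩
    push_cast at hz ⊢
    rw [← hz, ← hs, ← hn, ← pow_mul]
    simp only [hg, hp]
    have e1 : (2 : ℝ) ^ (n ^ 2 + 2 * v + 2) = 2 ^ v * 2 ^ v * 2 ^ (n ^ 2) * 4 := by ring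
    have e2 : (2 : ℝ) ^ (n ^ 2 + 2 * v + 1) = 2 ^ v * 2 ^ v * 2 ^ (n ^ 2) * 2 := by ring
    have e3 : (2 : ℝ) ^ (n * n) = 2 ^ (n ^ 2) := by rw [sq]
    rw [e1, e2, e3, hη]
    field_simp
    ring
  · rw [hg, cubeExpect_const_mul, cubeExpect_sub, hbal, hp, cubeExpect_const_mul]
    rw [cubeExpect_rieszIm, mul_zero, sub_zero, mul_zero]
  · intro b
    have h1 : (fun x => g x * sgn (x b)) = fun x =>
        (1 - η) * (sgn (f x) * sgn (x b) - η / 2 * (rieszIm c x * sgn (x b))) := by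
      funext x
      simp only [hg, hp]
      ring
    rw [h1, cubeExpect_const_mul, cubeExpect_sub, cubeExpect_const_mul,
      cubeExpect_rieszIm_mul_sgn]
    have : η / 2 * c b = a b := by
      simp only [hc]
      rw [pow_succ]
      linear_combination a b * hη2
    rw [this]
    simp [ha]
  · rw [← cubeExpect_const (ι := β) (1 - 2 * η)]
    refine cubeExpect_mono fun x => ?_
    have h1 : g x * sgn (f x) = (1 - η) * (1 - p x * sgn (f x)) := by
      simp only [hg]
      linear_combination (1 - η) * sgn_mul_self (f x)
    have h2 : p x * sgn (f x) ≤ η := by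
      refine (le_abs_self _).trans ?_
      rw [abs_mul, abs_sgn, mul_one]
      exact hpb x
    rw [h1]
    nlinarith

end Rounding

section Tribes

lemma exists_upperSet_card_eq {α : Type*} [PartialOrder α] [DecidableEq α] {A B : Finset α}
    (hA : IsUpperSet (A : Set α)) (hB : IsUpperSet (B : Set α)) (hAB : A ⊆ B) {m : ℕ}
    (hAm : #A ≤ m) (hmB : m ≤ #B) :
    ∃ U : Finset α, IsUpperSet (U : Set α) ∧ A ⊆ U ∧ U ⊆ B ∧ #U = m := by
  induction m, hAm using Nat.le_induction with
  | base => exact ⟨A, hA, subset_rfl, hAB, rfl⟩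
  | succ m hm ih =>
    obtain ⟨U, hU, hAU, hUB, hcard⟩ := ih (by omega)
    have hne : (B \ U).Nonempty := by
      rw [sdiff_nonempty]
      intro h
      have := card_le_card h
      omega
    obtain ⟨a, ha⟩ := (B \ U).exists_maximal hne
    have haBU := mem_sdiff.1 ha.prop
    refine ⟨insert a U, ?_, hAU.trans (subset_insert _ _), insert_subset haBU.1 hUB, ?_⟩
    · intro x y hxy hx
      rw [mem_coe, mem_insert] at hx ⊢
      rcases hx with rfl | hx
      · by_cases hy : y ∈ U
        · exact Or.inr hy
        · exact Or.inl (le_antisymm (ha.le_of_ge (mem_sdiff.2 ⟨hB hxy haBU.1, hy⟩) hxy) hxy)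
      · exact Or.inr (hU hxy hx)
    · rw [card_insert_of_notMem haBU.2, hcard]

variable {β : Type*} [Fintype β] [DecidableEq β]

/-- The fraction of the hypercube covered by `S`. -/
def density (S : Finset (β → Bool)) : ℝ := expect fun x => if x ∈ S then (1 : ℝ) else 0

lemma density_eq (S : Finset (β → Bool)) : density S = #S / 2 ^ Fintype.card β := by
  simp [density, _root_.expect]

lemma density_mono {S T : Finset (β → Bool)} (h : S ⊆ T) : density S ≤ density T := by
  rw [density_eq, density_eq]
  gcongr

lemma density_forall_true (P : Finset β) :
    density (univ.filter fun x : β → Bool => ∀ p ∈ P, x p = true) = 1 / 2 ^ #P := by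
  have h1 : (univ.filter fun x : β → Bool => ∀ p ∈ P, x p = true) =
      Fintype.piFinset fun p => if p ∈ P then {true} else univ := by
    ext x
    simp only [mem_filter, mem_univ, true_and, Fintype.mem_piFinset]
    refine forall_congr' fun p => ?_
    by_cases hp : p ∈ P <;> simp [hp]
  have h2 : (#(univ.filter fun x : β → Bool => ∀ p ∈ P, x p = true)) * 2 ^ #P =
      2 ^ Fintype.card β := by
    have h3 : ∏ p, (if p ∈ P then 2 else 1) = 2 ^ #P := by
      rw [prod_ite_mem, univ_inter, prod_const]
    rw [h1, Fintype.card_piFinset, ← h3, ← prod_mul_distrib, ← card_univ, ← prod_const]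
    refine prod_congr rfl fun p _ => ?_
    by_cases hp : p ∈ P <;> simp [hp]
  rw [density_eq, div_eq_div_iff (by positivity) (by positivity), one_mul]
  exact_mod_cast h2

/-- The event that one of the first `k` of `m` disjoint tribes of width `w` is unanimous. -/
def tribes (m w k : ℕ) : Finset (Fin m × Fin w → Bool) :=
  univ.filter fun x => ∃ j : Fin m, j.val < k ∧ ∀ i, x (j, i) = true

lemma mem_tribes {m w k : ℕ} {x : Fin m × Fin w → Bool} :
    x ∈ tribes m w k ↔ ∃ j : Fin m, j.val < k ∧ ∀ i, x (j, i) = true := by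
  simp [tribes]

lemma isUpperSet_tribes (m w k : ℕ) : IsUpperSet (tribes m w k : Set (Fin m × Fin w → Bool)) := by
  intro x y hxy hx
  rw [mem_coe, mem_tribes] at hx ⊢
  obtain ⟨j, hj, h⟩ := hx
  exact ⟨j, hj, fun i => Bool.eq_true_of_true_le (h i ▸ hxy (j, i))⟩

lemma tribes_subset_succ (m w k : ℕ) : tribes m w k ⊆ tribes m w (k + 1) := by
  intro x hx
  rw [mem_tribes] at hx ⊢
  obtain ⟨j, hj, h⟩ := hx
  exact ⟨j, by omega, h⟩

lemma density_tribes_succ_sdiff (m w k : ℕ) :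
    density (tribes m w (k + 1) \ tribes m w k) ≤ 1 / 2 ^ w := by
  by_cases hk : k < m
  · have hsub : tribes m w (k + 1) \ tribes m w k ⊆ univ.filter fun x =>
        ∀ p ∈ univ.image (fun i : Fin w => ((⟨k, hk⟩ : Fin m), i)), x p = true := by
      intro x hx
      rw [mem_sdiff, mem_tribes, mem_tribes] at hx
      obtain ⟨⟨j, hj, h⟩, h2⟩ := hx
      have hjk : j = ⟨k, hk⟩ := by
        ext
        change j.val = k
        by_contra hne
        exact h2 ⟨j, by omega, h⟩
      subst hjk
      simpa using h
    refine (density_mono hsub).trans_eq ?_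
    rw [density_forall_true, card_image_of_injective _ fun a b h => (Prod.ext_iff.1 h).2]
    simp
  · have hempty : tribes m w (k + 1) \ tribes m w k = ∅ := by
      rw [sdiff_eq_empty_iff_subset]
      intro x hx
      rw [mem_tribes] at hx ⊢
      obtain ⟨j, hj, h⟩ := hx
      exact ⟨j, by omega, h⟩
    rw [hempty, density_eq]
    simp

lemma density_tribes_top (m w : ℕ) :
    density (tribes m w m) = 1 - (1 - 1 / 2 ^ w) ^ m := by
  let h : (Fin w → Bool) → Bool := fun z => decide (∀ i, z i = true)
  have h1 : density (univ.filter fun z : Fin w → Bool => ∀ p ∈ univ, z p = true) = 1 / 2 ^ w := by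
    simpa using density_forall_true (univ : Finset (Fin w))
  have h2 : expect (fun z => if h z = false then (1 : ℝ) else 0) = 1 - 1 / 2 ^ w := by
    rw [← h1, density, ← cubeExpect_const (ι := Fin w) 1, ← cubeExpect_sub, cubeExpect_const]
    congr 1
    funext z
    by_cases hz : ∀ i, z i = true <;> simp [h, hz]
  have key := cubeExpect_blocks (fun _ : Fin m => h) (fun _ _ => 1)
    fun y => if y = (fun _ => false) then 1 else 0
  rw [Fintype.sum_eq_single (fun _ => false) (by intro y hy; simp [hy])] at key
  simp only [prod_const_one, mul_one, if_true, one_mul, h2, prod_const, card_univ,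
    Fintype.card_fin] at key
  rw [← key, density, ← cubeExpect_const (ι := Fin m × Fin w) 1, ← cubeExpect_sub,
    cubeExpect_const]
  congr 1
  funext x
  by_cases hx : ∃ j : Fin m, ∀ i, x (j, i) = true
  · have h3 : x ∈ tribes m w m := by
      obtain ⟨j, hj⟩ := hx
      exact mem_tribes.2 ⟨j, j.isLt, hj⟩
    have h4 : ¬ (fun b : Fin m => h fun i => x (b, i)) = fun _ => false := by
      intro h5
      obtain ⟨j, hj⟩ := hx
      have := congrFun h5 j
      simp [h, hj] at this
    simp [h3, h4]
  · have h3 : x ∉ tribes m w m := by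
      rw [mem_tribes]
      rintro ⟨j, -, hj⟩
      exact hx ⟨j, hj⟩
    have h4 : (fun b : Fin m => h fun i => x (b, i)) = fun _ => false := by
      funext b
      simpa [h] using not_exists.1 hx b
    simp [h3, h4]

lemma half_le_density_tribes_top (w : ℕ) : 1 / 2 ≤ density (tribes (2 ^ w) w (2 ^ w)) := by
  rw [density_tribes_top]
  have hM : (1 : ℝ) ≤ ((2 ^ w : ℕ) : ℝ) := by exact_mod_cast Nat.one_le_two_pow
  have h := Real.one_sub_div_pow_le_exp_neg (n := 2 ^ w) (t := 1) hM
  have h2 := Real.exp_neg_one_lt_d9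
  push_cast at h
  linarith

lemma influence_le_of_tribes {m w k : ℕ} (hw : 1 ≤ w) {U : Finset (Fin m × Fin w → Bool)}
    (hU : IsUpperSet (U : Set (Fin m × Fin w → Bool))) (h1 : tribes m w k ⊆ U)
    (h2 : U ⊆ tribes m w (k + 1)) (b : Fin m × Fin w) :
    influence (fun x => decide (x ∈ U)) b ≤ 4 / 2 ^ w := by
  obtain ⟨j, i⟩ := b
  set P : Finset (Fin m × Fin w) := (univ.erase i).image fun i' => (j, i') with hP
  set A := univ.filter fun x : Fin m × Fin w → Bool => ∀ p ∈ P, x p = true with hA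
  set V := U \ tribes m w k with hV
  have hAd : density A = 2 / 2 ^ w := by
    rw [hA, density_forall_true, hP,
      card_image_of_injective _ fun a b h => (Prod.ext_iff.1 h).2, card_erase_of_mem (mem_univ i),
      card_univ, Fintype.card_fin]
    obtain ⟨w, rfl⟩ := Nat.exists_eq_add_of_le' hw
    rw [Nat.add_sub_cancel, pow_succ]
    field_simp
  have hVd : density V ≤ 1 / 2 ^ w :=
    (density_mono (sdiff_subset_sdiff h2 subset_rfl)).trans (density_tribes_succ_sdiff m w k)
  have hVe := cubeExpect_eq_update (fun x => if x ∈ V then (1 : ℝ) else 0) (j, i)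
  have hbound : influence (fun x => decide (x ∈ U)) (j, i) ≤ density A + 2 * density V := by
    conv_rhs => rw [density, density, hVe, ← cubeExpect_const_mul, ← cubeExpect_add]
    refine cubeExpect_mono fun x => ?_
    set xt := Function.update x (j, i) true with hxt
    set xf := Function.update x (j, i) false with hxf
    have hle : xf ≤ xt := by
      rw [update_le_update_iff]
      exact ⟨by simp, fun _ _ => le_rfl⟩
    have hA0 : (0 : ℝ) ≤ if x ∈ A then 1 else 0 := by split_ifs <;> norm_num
    have hV0 : (0 : ℝ) ≤ if xf ∈ V then 1 else 0 := by split_ifs <;> norm_num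
    have hV1 : (0 : ℝ) ≤ if xt ∈ V then 1 else 0 := by split_ifs <;> norm_num
    change (if decide (xt ∈ U) = decide (xf ∈ U) then (0 : ℝ) else 1) ≤ (if x ∈ A then 1 else 0) +
      2 * (1 / 2 * ((if xt ∈ V then 1 else 0) + if xf ∈ V then 1 else 0))
    by_cases hf : xf ∈ U
    · have ht : xt ∈ U := hU hle hf
      simp only [hf, ht, if_true]
      linarith
    by_cases ht : xt ∈ U
    · by_cases htV : xt ∈ V
      · simp only [hf, ht, htV, if_true, decide_true, decide_false]
        norm_num at hA0 hV0 hV1 ⊢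
        linarith
      · have hxA : x ∈ A := by
          have htr : xt ∈ tribes m w k := by
            by_contra hcon
            exact htV (mem_sdiff.2 ⟨ht, hcon⟩)
          obtain ⟨j', hj', hall⟩ := mem_tribes.1 htr
          have hjj : j' = j := by
            by_contra hne
            refine hf (h1 (mem_tribes.2 ⟨j', hj', fun i' => ?_⟩))
            have := hall i'
            rw [hxt, Function.update_of_ne (by simp [hne])] at this
            rwa [hxf, Function.update_of_ne (by simp [hne])]
          subst hjj
          rw [hA, mem_filter]
          refine ⟨mem_univ _, fun p hp => ?_⟩
          obtain ⟨i', hi', rfl⟩ := mem_image.1 hp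
          have := hall i'
          rwa [hxt, Function.update_of_ne (by simpa using hi')] at this
        simp only [hf, ht, hxA, if_true, decide_true, decide_false]
        norm_num at hA0 hV0 hV1 ⊢
        linarith
    · simp only [hf, ht, if_true]
      linarith
  calc _ ≤ density A + 2 * density V := hbound
    _ ≤ 2 / 2 ^ w + 2 * (1 / 2 ^ w) := by rw [hAd]; gcongr
    _ = 4 / 2 ^ w := by ring

/-- There is an exactly balanced monotone function all of whose influences are within a logarithmic
factor of the smallest possible. -/
lemma exists_balanced_monotone_small_influence (w : ℕ) (hw : 1 ≤ w) :
    ∃ f : (Fin (2 ^ w) × Fin w → Bool) → Bool, Monotone f ∧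
      expect (fun x => sgn (f x)) = 0 ∧ ∀ b, influence f b ≤ 4 / 2 ^ w := by
  set n := Fintype.card (Fin (2 ^ w) × Fin w) with hn
  have hn1 : 1 ≤ n := by
    rw [hn, Fintype.card_prod, Fintype.card_fin, Fintype.card_fin]
    exact Nat.mul_pos (by positivity) hw
  obtain ⟨q, hq⟩ := Nat.exists_eq_add_of_le' hn1
  have hex : ∃ k, 2 ^ q ≤ #(tribes (2 ^ w) w k) := by
    refine ⟨2 ^ w, ?_⟩
    have h := half_le_density_tribes_top w
    rw [density_eq, ← hn, hq, pow_succ, div_le_div_iff₀ (by norm_num) (by positivity)] at h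
    have : ((2 ^ q : ℕ) : ℝ) ≤ #(tribes (2 ^ w) w (2 ^ w)) := by
      push_cast
      linarith
    exact_mod_cast this
  obtain ⟨k, hk1, hk2⟩ : ∃ k, #(tribes (2 ^ w) w k) ≤ 2 ^ q ∧
      2 ^ q ≤ #(tribes (2 ^ w) w (k + 1)) := by
    have h0 : Nat.find hex ≠ 0 := by
      intro h0
      have := Nat.find_spec hex
      rw [h0] at this
      have hempty : tribes (2 ^ w) w 0 = ∅ := by
        ext x
        simp [mem_tribes]
      rw [hempty, card_empty] at this
      exact absurd this (by simp)
    obtain ⟨k, hk⟩ := Nat.exists_eq_succ_of_ne_zero h0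
    refine ⟨k, ?_, ?_⟩
    · have := Nat.find_min hex (m := k) (by omega)
      omega
    · have := Nat.find_spec hex
      rwa [hk] at this
  obtain ⟨U, hU, hU1, hU2, hcard⟩ := exists_upperSet_card_eq (isUpperSet_tribes _ _ k)
    (isUpperSet_tribes _ _ (k + 1)) (tribes_subset_succ _ _ k) hk1 hk2
  refine ⟨fun x => decide (x ∈ U), ?_, ?_, influence_le_of_tribes hw hU hU1 hU2⟩
  · intro x y hxy
    by_cases hx : x ∈ U
    · have hy : y ∈ U := hU hxy hx
      simp [hx, hy]
    · simp [hx]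
  · have h1 : ∀ x, sgn (decide (x ∈ U)) = 2 * (if x ∈ U then (1 : ℝ) else 0) - 1 := by
      intro x
      by_cases hx : x ∈ U
      · norm_num [sgn, hx]
      · norm_num [sgn, hx]
    simp_rw [h1]
    rw [cubeExpect_sub, cubeExpect_const_mul, cubeExpect_const]
    have h2 := density_eq U
    rw [density, hcard, ← hn, hq, pow_succ] at h2
    rw [h2]
    push_cast
    field_simp
    norm_num

end Tribes

section Parameters

/-- A base pair for the amplification, with error `2^{-v}` and total influence `O(v)` on
`2^{O(v)}` variables. -/
lemma exists_base_pair (v : ℕ) (hv : 8 ≤ v) :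
    ∃ (r : ℕ) (F G : ((Fin (2 ^ (4 * v)) × Fin (4 * v)) ⊕ (Fin r ⊕ Fin r) → Bool) → Bool),
      r = (2 ^ (4 * v) * (4 * v)) ^ 2 + 2 * v + 2 ∧ ResilientPair 1 (1 / 2 ^ v) F G ∧
      ∑ i, influence F i ≤ 16 * v := by
  obtain ⟨f, hmono, hbal, hinf⟩ := exists_balanced_monotone_small_influence (4 * v) (by omega)
  have hpow : (256 : ℝ) * v ≤ 2 ^ (2 * v) := by
    have h1 : v ≤ 2 ^ v := Nat.lt_two_pow_self.le
    have h2 : 2 ^ 8 ≤ 2 ^ v := Nat.pow_le_pow_right (by norm_num) hv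
    have h3 : 256 * v ≤ 2 ^ (2 * v) := by
      rw [two_mul, pow_add]
      exact Nat.mul_le_mul h2 h1
    exact_mod_cast h3
  have hsq : ∑ b, influence f b ^ 2 ≤ (1 / 2 ^ (v + 1)) ^ 2 := by
    calc ∑ b, influence f b ^ 2 ≤ ∑ _b : Fin (2 ^ (4 * v)) × Fin (4 * v), (4 / 2 ^ (4 * v)) ^ 2 :=
          sum_le_sum fun b _ => by
            have := disagreement_nonneg (fun x => f (Function.update x b true)) fun x =>
              f (Function.update x b false)
            exact pow_le_pow_left₀ this (hinf b) 2
      _ = 64 * v / 2 ^ (4 * v) := by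
          rw [sum_const, card_univ, Fintype.card_prod, Fintype.card_fin, Fintype.card_fin,
            nsmul_eq_mul]
          push_cast
          field_simp
          ring
      _ ≤ (1 / 2 ^ (v + 1)) ^ 2 := by
          have e1 : (2 : ℝ) ^ (4 * v) = 2 ^ (2 * v) * 2 ^ (2 * v) := by ring
          have e2 : ((1 : ℝ) / 2 ^ (v + 1)) ^ 2 = 1 / (4 * 2 ^ (2 * v)) := by
            rw [div_pow, one_pow, ← pow_mul]
            congr 1
            ring
          rw [e1, e2, div_le_div_iff₀ (by positivity) (by positivity)]
          have : (0 : ℝ) < 2 ^ (2 * v) := by positivity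
          nlinarith
  obtain ⟨r, F, G, hr, hFG, hsum⟩ := exists_oneResilient_pair v hmono hbal hsq
  refine ⟨r, F, G, by simpa using hr, hFG, ?_⟩
  rw [hsum]
  calc ∑ b, influence f b ≤ ∑ _b : Fin (2 ^ (4 * v)) × Fin (4 * v), (4 : ℝ) / 2 ^ (4 * v) :=
        sum_le_sum fun b _ => hinf b
    _ = 16 * v := by
        rw [sum_const, card_univ, Fintype.card_prod, Fintype.card_fin, Fintype.card_fin,
          nsmul_eq_mul]
        push_cast
        field_simp
        ring

lemma card_base_le (v : ℕ) (hv : 8 ≤ v) :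
    2 ^ (4 * v) * (4 * v) + 2 * ((2 ^ (4 * v) * (4 * v)) ^ 2 + 2 * v + 2) ≤ 2 ^ (12 * v) := by
  have h1 : v ≤ 2 ^ v := Nat.lt_two_pow_self.le
  have h2 : 2 ^ 8 ≤ 2 ^ v := Nat.pow_le_pow_right (by norm_num) hv
  have e1 : 2 ^ (4 * v) = (2 ^ v) ^ 4 := by rw [← pow_mul, mul_comm]
  have e2 : 2 ^ (12 * v) = (2 ^ v) ^ 12 := by rw [← pow_mul, mul_comm]
  rw [e1, e2]
  generalize 2 ^ v = a at *
  have h3 : 256 ≤ a := by simpa using h2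
  have h4 : a ^ 4 * (4 * v) ≤ a ^ 4 * (4 * a) := by gcongr
  have h5 : (a ^ 4 * (4 * v)) ^ 2 ≤ (a ^ 4 * (4 * a)) ^ 2 := by gcongr
  have h6 : (a ^ 4 * (4 * a)) ^ 2 = 16 * a ^ 10 := by ring
  have h7 : a ^ 4 * (4 * a) = 4 * a ^ 5 := by ring
  have h8 : a ^ 5 ≤ a ^ 10 := Nat.pow_le_pow_right (by omega) (by norm_num)
  have h9 : a ≤ a ^ 10 := Nat.le_self_pow (by norm_num) a
  have h10 : 256 * 256 * a ^ 10 ≤ a ^ 12 := by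
    calc 256 * 256 * a ^ 10 ≤ a * a * a ^ 10 := by gcongr
      _ = a ^ 12 := by ring
  omega

/-- The amplified pair: `k` levels of composition reach resilience `2^k - 1`. -/
lemma exists_amplified_pair (t v k : ℕ) (hv : 8 ≤ v) (ht : 2 ^ t = 32 * v) :
    ∃ C : ℕ, 2 ^ v ≤ C ∧ C ≤ 2 ^ (12 * v) ∧ ∃ F G : (Fin (C ^ k) → Bool) → Bool,
      ResilientPair (2 ^ k - 1) (2 ^ (t * k) / 2 ^ v) F G := by
  obtain ⟨r, F, G, hr, hFG, hsum⟩ := exists_base_pair v hv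
  have hJ : 1 + ∑ i, influence F i ≤ 2 ^ t := by
    have h1 : (2 : ℝ) ^ t = 32 * v := by exact_mod_cast ht
    have h2 : (8 : ℝ) ≤ v := by exact_mod_cast hv
    linarith
  obtain ⟨F', G', h⟩ := hFG.iterate hJ k
  have hC : Fintype.card ((Fin (2 ^ (4 * v)) × Fin (4 * v)) ⊕ (Fin r ⊕ Fin r)) =
      2 ^ (4 * v) * (4 * v) + 2 * r := by
    simp
    ring
  refine ⟨_, ?_, ?_, F', G', h.monotone, h.balanced, h.resilient, h.disagreement_le.trans_eq ?_⟩
  · rw [hC]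
    calc 2 ^ v ≤ 2 ^ (4 * v) := Nat.pow_le_pow_right (by norm_num) (by omega)
      _ ≤ 2 ^ (4 * v) * (4 * v) := Nat.le_mul_of_pos_right _ (by omega)
      _ ≤ _ := Nat.le_add_right _ _
  · rw [hC, hr]
    exact card_base_le v hv
  · rw [← pow_mul]
    ring

/-- The growth rate of the resilience in terms of the number of variables. -/
lemma sqrt_log_div_loglog_le {t v k N : ℕ} (ht : 12 ≤ t) (hv : 32 * v = 2 ^ t)
    (hk : k * 2 * t = v) (hk2 : 2 ≤ k) (hN1 : 2 ^ v ≤ N) (hN2 : N ≤ 2 ^ (12 * v * k)) :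
    1 / 64 * Real.sqrt (Real.log N) / Real.log (Real.log N) ≤ (k : ℝ) - 1 := by
  have hlog2 : 1 / 2 ≤ Real.log 2 := by linarith [Real.log_two_gt_d9]
  have hlog2' : Real.log 2 ≤ 1 := by linarith [Real.log_two_lt_d9]
  have hkv : (k : ℝ) ≤ v := by
    have : k ≤ v := by nlinarith
    exact_mod_cast this
  have hv0 : (0 : ℝ) ≤ v := Nat.cast_nonneg v
  have hk0 : (0 : ℝ) ≤ k := Nat.cast_nonneg k
  have hNpos : (0 : ℝ) < N := by
    have : 0 < N := lt_of_lt_of_le (by positivity) hN1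
    exact_mod_cast this
  have hup : Real.log N ≤ 16 * v ^ 2 := by
    have h1 : Real.log N ≤ Real.log (2 ^ (12 * v * k)) :=
      Real.log_le_log hNpos (by exact_mod_cast hN2)
    rw [Real.log_pow] at h1
    push_cast at h1
    have h2 : 12 * (v : ℝ) * k * Real.log 2 ≤ 12 * v * k * 1 := by gcongr
    have h3 : 12 * (v : ℝ) * k ≤ 12 * v * v := by gcongr
    nlinarith
  have hlow : (v : ℝ) / 2 ≤ Real.log N := by
    have h1 : Real.log (2 ^ v) ≤ Real.log N :=
      Real.log_le_log (by positivity) (by exact_mod_cast hN1)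
    rw [Real.log_pow] at h1
    nlinarith
  have hsqrt : Real.sqrt (Real.log N) ≤ 4 * v := by
    rw [Real.sqrt_le_left (by positivity)]
    linarith
  have htR : (12 : ℝ) ≤ t := by exact_mod_cast ht
  have hloglog : (t : ℝ) / 4 ≤ Real.log (Real.log N) := by
    have h1 : (2 : ℝ) ^ (t - 6) ≤ Real.log N := by
      have e : 2 ^ t = 2 ^ (t - 6) * 2 ^ 6 := by rw [← pow_add]; congr 1; omega
      have e2 : 32 * (v : ℝ) = 2 ^ (t - 6) * 2 ^ 6 := by exact_mod_cast hv.trans e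
      linarith
    have h2 := Real.log_le_log (by positivity) h1
    rw [Real.log_pow, Nat.cast_sub (by omega)] at h2
    push_cast at h2
    nlinarith
  have hkt : (k : ℝ) * 2 * t = v := by exact_mod_cast hk
  have hk2R : (2 : ℝ) ≤ k := by exact_mod_cast hk2
  rw [div_le_iff₀ (by linarith)]
  calc 1 / 64 * Real.sqrt (Real.log N) ≤ 1 / 64 * (4 * v) := by gcongr
    _ = (k / 2) * (t / 4) := by rw [← hkt]; ring
    _ ≤ (k - 1) * Real.log (Real.log N) :=
        mul_le_mul (by linarith) hloglog (by positivity) (by linarith)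

/-- Arbitrarily large parameters for the amplification. -/
lemma exists_parameters (ε : ℝ) (hε : 0 < ε) (M : ℕ) :
    ∃ t v k : ℕ, 12 ≤ t ∧ 8 ≤ v ∧ 2 ^ t = 32 * v ∧ k * 2 * t = v ∧ 2 ≤ k ∧ M ≤ 2 ^ v ∧
      (2 : ℝ) ^ (t * k) / 2 ^ v ≤ ε := by
  obtain ⟨m, hm⟩ := exists_nat_gt (1 / ε)
  obtain ⟨u, hu5, hum, huM⟩ : ∃ u, 5 ≤ u ∧ m ≤ u ∧ M ≤ u :=
    ⟨max 5 (max m M), le_max_left _ _, (le_max_left _ _).trans (le_max_right _ _),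
      (le_max_right _ _).trans (le_max_right _ _)⟩
  have hgen : ∀ u, 5 ≤ u → 2 * u + 8 ≤ 2 ^ u := by
    intro u hu
    induction u, hu using Nat.le_induction with
    | base => norm_num
    | succ u hu ih => rw [pow_succ]; omega
  have hut := hgen u hu5
  obtain ⟨s, hs⟩ := Nat.exists_eq_add_of_le' (show u + 7 ≤ 2 ^ u by omega)
  have hs1 : u ≤ s + 1 := by omega
  have hsu : s + 1 ≤ 2 ^ (s + 1) := Nat.lt_two_pow_self.le
  refine ⟨2 ^ u, 2 ^ (s + u + 2), 2 ^ (s + 1), by omega, ?_, ?_, ?_, ?_, ?_, ?_⟩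
  · calc 8 = 2 ^ 3 := by norm_num
      _ ≤ 2 ^ (s + u + 2) := Nat.pow_le_pow_right (by norm_num) (by omega)
  · conv_lhs => rw [hs]
    ring
  · ring
  · exact Nat.le_self_pow (by omega) 2
  · calc M ≤ u := huM
      _ ≤ s + u + 2 := by omega
      _ ≤ 2 ^ (s + u + 2) := Nat.lt_two_pow_self.le
      _ ≤ 2 ^ 2 ^ (s + u + 2) := Nat.lt_two_pow_self.le
  · have e1 : 2 ^ u * 2 ^ (s + 1) = 2 ^ (s + u + 1) := by ring
    have e2 : 2 ^ (s + u + 2) = 2 ^ (s + u + 1) + 2 ^ (s + u + 1) := by ring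
    rw [e1, e2, pow_add (2 : ℝ) (2 ^ (s + u + 1)) (2 ^ (s + u + 1)),
      div_mul_cancel_left₀ (by positivity)]
    refine inv_le_of_inv_le₀ hε ?_
    rw [← one_div]
    have hle : m ≤ 2 ^ 2 ^ (s + u + 1) :=
      calc m ≤ s + u + 1 := by omega
        _ ≤ 2 ^ (s + u + 1) := Nat.lt_two_pow_self.le
        _ ≤ 2 ^ 2 ^ (s + u + 1) := Nat.lt_two_pow_self.le
    exact hm.le.trans (mod_cast hle)

end Parameters

/-- **Explicit monotone functions close to highly resilient Boolean functions (amplified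
CycleRun).** There is a universal `c > 0` such that for every `ε > 0` there are arbitrarily
large `N` admitting a monotone Boolean `F : {-1,1}^N → {-1,1}` and a Boolean
`G : {-1,1}^N → {-1,1}` such that `G` is `d`-resilient for some
`d ≥ 2^{c·√(log N)/log log N}` and `Pr_x[F(x) ≠ G(x)] ≤ ε`. -/
theorem stmt14 :
    ∃ c : ℝ, 0 < c ∧
      ∀ ε : ℝ, 0 < ε → ∀ M : ℕ, ∃ N : ℕ, M ≤ N ∧
        ∃ F G : (Fin N → Bool) → ℝ,
          IsBooleanValued F ∧ Monotone F ∧ IsBooleanValued G ∧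
          ∃ d : ℕ,
            (2 : ℝ) ^ (c * Real.sqrt (Real.log N) / Real.log (Real.log N)) ≤ (d : ℝ) ∧
            Resilient d G ∧
            expect (fun x => if F x = G x then (0 : ℝ) else 1) ≤ ε := by
  refine ⟨1 / 64, by norm_num, fun ε hε M => ?_⟩
  obtain ⟨t, v, k, ht, hv, htv, hkt, hk, hM, herr⟩ := exists_parameters ε hε M
  obtain ⟨C, hC1, hC2, F, G, h⟩ := exists_amplified_pair t v k hv htv
  have hN1 : 2 ^ v ≤ C ^ k := hC1.trans (Nat.le_self_pow (by omega) C)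
  have hN2 : C ^ k ≤ 2 ^ (12 * v * k) := by
    rw [pow_mul]
    exact Nat.pow_le_pow_left hC2 k
  have hgrowth := sqrt_log_div_loglog_le ht htv.symm hkt hk hN1 hN2
  refine ⟨C ^ k, hM.trans hN1, fun x => sgn (F x), fun x => sgn (G x), fun x => ?_,
    sgn_monotone.comp h.monotone, fun x => ?_, 2 ^ k - 1, ?_, h.resilient, ?_⟩
  · exact sgn_eq_one_or _
  · exact sgn_eq_one_or _
  · refine (Real.rpow_le_rpow_of_exponent_le (by norm_num) hgrowth).trans ?_
    obtain ⟨k, rfl⟩ := Nat.exists_eq_add_of_le' (show 1 ≤ k by omega)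
    push_cast
    rw [add_sub_cancel_right, Real.rpow_natCast, Nat.cast_sub Nat.one_le_two_pow]
    have : (1 : ℝ) ≤ 2 ^ k := one_le_pow₀ (by norm_num)
    push_cast
    rw [pow_succ]
    linarith
  · refine le_trans (le_of_eq ?_) (h.disagreement_le.trans herr)
    simp only [disagreement, sgn_injective.eq_iff]
end
end

section
/- There exists a universal constant C > 0 such that for every n ≥ 2, E_x[ℓ(x)·r_{ℓ(x)}(x)] ≤ C·log n, where x is uniform on {-1,1}^n. -/
open Finset

noncomputable section

/-- The set of starting positions of (maximal, non-wrapping) runs of `x`: position `a` starts a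
run iff `a = 0` or `x (a-1) ≠ x a`. -/
def runStarts (n : ℕ) (x : Fin n → Bool) : Finset (Fin n) :=
  Finset.univ.filter (fun a : Fin n =>
    a.val = 0 ∨ x a ≠ x ⟨a.val - 1, lt_of_le_of_lt (Nat.sub_le _ _) a.isLt⟩)

/-- The length of the maximal constant block of `x` starting at `a`: the number of positions
`j ≥ a` such that all coordinates from `a` through `j` equal `x a`.  For `a` a run start this is
the length of the run starting at `a`. -/
def runLen (n : ℕ) (x : Fin n → Bool) (a : Fin n) : ℕ :=
  (Finset.univ.filter (fun j : Fin n =>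
    a ≤ j ∧ ∀ k : Fin n, a ≤ k → k ≤ j → x k = x a)).card

/-- `ℓ(x)`: the length of the longest run of `x`. -/
def maxRun (n : ℕ) (x : Fin n → Bool) : ℕ := (runStarts n x).sup (runLen n x)

/-- `r_i(x)`: the number of (maximal) runs of `x` of length exactly `i`. -/
def numRuns (n : ℕ) (x : Fin n → Bool) (i : ℕ) : ℕ :=
  ((runStarts n x).filter (fun a => runLen n x a = i)).card

theorem lt_runLen_iff {n : ℕ} (x : Fin n → Bool) (a : Fin n) (k : ℕ) :
    k < runLen n x a ↔
      a.val + k < n ∧ ∀ j : Fin n, a ≤ j → j.val ≤ a.val + k → x j = x a := by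
  unfold runLen
  constructor
  · contrapose!
    intro h
    have hsub : (univ.filter fun j : Fin n =>
        a ≤ j ∧ ∀ i : Fin n, a ≤ i → i ≤ j → x i = x a).map Fin.valEmbedding ⊆
        Ico a.val (a.val + k) := by
      intro j hj
      simp only [mem_map, mem_filter, mem_univ, true_and, Fin.valEmbedding_apply] at hj
      obtain ⟨j, ⟨haj, hc⟩, rfl⟩ := hj
      refine mem_Ico.2 ⟨haj, ?_⟩
      by_contra! hlt
      obtain ⟨i, hai, hik, hne⟩ := h (by omega)
      exact hne (hc i hai (Fin.le_def.2 (by omega)))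
    simpa using card_le_card hsub
  · rintro ⟨hk, hc⟩
    have hsub : Icc a ⟨a.val + k, hk⟩ ⊆ univ.filter fun j : Fin n =>
        a ≤ j ∧ ∀ i : Fin n, a ≤ i → i ≤ j → x i = x a := by
      intro j hj
      rw [mem_Icc, Fin.le_def, Fin.le_def] at hj
      exact mem_filter.2 ⟨mem_univ _, hj.1, fun i hai hij =>
        hc i hai ((Fin.le_def.1 hij).trans hj.2)⟩
    have := card_le_card hsub
    simp only [Fin.card_Icc] at this
    omega

theorem add_runLen_le {n : ℕ} (x : Fin n → Bool) (a : Fin n) : a.val + runLen n x a ≤ n := by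
  rcases Nat.eq_zero_or_pos (runLen n x a) with h | h
  · omega
  · have := ((lt_runLen_iff x a (runLen n x a - 1)).1 (by omega)).1
    omega

theorem eq_of_lt_runLen {n : ℕ} (x : Fin n → Bool) (a j : Fin n) (haj : a ≤ j)
    (hj : j.val < a.val + runLen n x a) : x j = x a :=
  ((lt_runLen_iff x a (j.val - a.val)).1 (by omega)).2 j haj (by omega)

theorem exists_runStart_runLen_le {n : ℕ} (x : Fin n → Bool) (a : Fin n) :
    ∃ b ∈ runStarts n x, runLen n x a ≤ runLen n x b := by
  obtain ⟨k, hk⟩ := a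
  induction k with
  | zero => exact ⟨⟨0, hk⟩, by simp [runStarts], le_rfl⟩
  | succ k ih =>
    by_cases hs : (⟨k + 1, hk⟩ : Fin n) ∈ runStarts n x
    · exact ⟨_, hs, le_rfl⟩
    · obtain ⟨b, hb, hle⟩ := ih (by omega)
      refine ⟨b, hb, le_trans ?_ hle⟩
      have heq : x ⟨k + 1, hk⟩ = x ⟨k, by omega⟩ := by simpa [runStarts] using hs
      refine le_of_forall_lt fun m hm => ?_
      rw [lt_runLen_iff] at hm ⊢
      refine ⟨by simp only at hm ⊢; omega, fun j hkj hj => ?_⟩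
      rcases eq_or_lt_of_le hkj with rfl | hlt
      · rfl
      · rw [← heq]
        exact hm.2 j (Fin.le_def.2 hlt) (by simp only at hj ⊢; omega)

theorem runLen_le_maxRun {n : ℕ} (x : Fin n → Bool) (a : Fin n) : runLen n x a ≤ maxRun n x := by
  obtain ⟨b, hb, hle⟩ := exists_runStart_runLen_le x a
  exact hle.trans (le_sup (f := runLen n x) hb)

/-- Duplicating one letter of a longest block makes that block the unique longest one, so its
position can be recovered. -/
theorem eq_of_duplicate_eq {X Y : ℕ → Bool} {a b l m n : ℕ} (hlm : l ≤ m) (hal : a + l ≤ n)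
    (hbm : b + m ≤ n) (hX : ∀ j, a ≤ j → j < a + l → X j = X a)
    (hY : ∀ j, b ≤ j → j < b + m → Y j = Y b)
    (hmax : ∀ s, s + l < n → ∃ j, s ≤ j ∧ j ≤ s + l ∧ X j ≠ X s)
    (hdup : ∀ i ≤ n, (if i ≤ a then X i else X (i - 1)) = if i ≤ b then Y i else Y (i - 1)) :
    a = b := by
  have hB : ∀ i, b ≤ i → i ≤ b + m → (if i ≤ a then X i else X (i - 1)) = Y b := by
    intro i hbi him
    rw [hdup i (by omega)]
    split_ifs with h
    · rw [le_antisymm h hbi]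
    · exact hY _ (by omega) (by omega)
  rcases lt_trichotomy a b with h | h | h
  · obtain ⟨j, hj, hjl, hne⟩ := hmax (b - 1) (by omega)
    have h₁ := hB (j + 1) (by omega) (by omega)
    have h₂ := hB b le_rfl (by omega)
    rw [if_neg (by omega)] at h₁ h₂
    exact absurd (h₁.trans h₂.symm) hne
  · exact h
  · obtain ⟨j, hj, hjl, hne⟩ := hmax b (by omega)
    have h₀ := hB b le_rfl (by omega)
    rw [if_pos h.le] at h₀
    refine absurd ?_ hne
    rw [h₀]
    by_cases hja : j ≤ a
    · simpa [hja] using hB j hj (by omega)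
    · rw [hX j (by omega) (by omega)]
      simpa using hB a h.le (by omega)

/-- The pairs of a point and a position at which a longest run of that point starts. -/
def longestRunPairs (n : ℕ) : Finset ((Fin n → Bool) × Fin n) :=
  univ.filter fun p => runLen n p.1 p.2 = maxRun n p.1

/-- The string obtained from `x` by repeating its letter at position `a`. -/
def duplicate {n : ℕ} (p : (Fin n → Bool) × Fin n) : Fin (n + 1) → Bool :=
  fun i => p.1 (p.2.predAbove i)

theorem duplicate_position_eq {n : ℕ} {p q : (Fin n → Bool) × Fin n}
    (hp : p ∈ longestRunPairs n) (hq : q ∈ longestRunPairs n) (h : duplicate p = duplicate q)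
    (hle : maxRun n p.1 ≤ maxRun n q.1) : p.2 = q.2 := by
  obtain ⟨x, a⟩ := p
  obtain ⟨y, b⟩ := q
  simp only [longestRunPairs, mem_filter, mem_univ, true_and] at hp hq hle
  have hn : 0 < n := a.pos
  let e : (Fin n → Bool) → ℕ → Bool := fun u i => if hi : i < n then u ⟨i, hi⟩ else false
  have he : ∀ u (i : Fin n), e u i = u i := fun u i => by simp [e]
  have hconst : ∀ u (c : Fin n) j, c.val ≤ j → j < c.val + runLen n u c → e u j = e u c := by
    intro u c j hcj hj
    have hjn : j < n := hj.trans_le (add_runLen_le u c)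
    exact (he u ⟨j, hjn⟩).trans ((eq_of_lt_runLen u c ⟨j, hjn⟩ hcj hj).trans (he u c).symm)
  have hdup : ∀ u (c : Fin n) (i : Fin (n + 1)),
      duplicate (u, c) i = if i.val ≤ c.val then e u i else e u (i - 1) := by
    intro u c i
    change u (c.predAbove i) = _
    rw [← he u (c.predAbove i)]
    simp only [Fin.predAbove, Fin.lt_def, Fin.val_castSucc]
    split_ifs with h₁ h₂ h₂
    · omega
    · rfl
    · rfl
    · omega
  refine Fin.ext (eq_of_duplicate_eq (X := e x) (Y := e y) (n := n) hle
    (hp ▸ add_runLen_le x a) (hq ▸ add_runLen_le y b) (hp ▸ hconst x a) (hq ▸ hconst y b) ?_ ?_)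
  · intro s hs
    have hnot := (lt_runLen_iff x ⟨s, by omega⟩ (maxRun n x)).not.1 (runLen_le_maxRun x _).not_gt
    push Not at hnot
    obtain ⟨j, hsj, hj, hne⟩ := hnot hs
    exact ⟨j, hsj, hj, by rwa [he x j, he x ⟨s, by omega⟩]⟩
  · intro i hi
    have := congrFun h ⟨i, by omega⟩
    rwa [hdup, hdup] at this

theorem duplicate_injOn (n : ℕ) : Set.InjOn duplicate (longestRunPairs n : Set ((Fin n → Bool) × Fin n)) := by
  intro p hp q hq h
  have hpos : p.2 = q.2 := by
    rcases le_total (maxRun n p.1) (maxRun n q.1) with hle | hle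
    · exact duplicate_position_eq hp hq h hle
    · exact (duplicate_position_eq hq hp h.symm hle).symm
  refine Prod.ext (funext fun i => ?_) hpos
  obtain ⟨j, rfl⟩ := Fin.predAbove_surjective p.2 i
  have := congrFun h j
  simp only [duplicate] at this
  rwa [← hpos] at this

theorem card_longestRunPairs_le (n : ℕ) : (longestRunPairs n).card ≤ 2 ^ (n + 1) := by
  simpa using card_le_card_of_injOn duplicate (fun _ _ => mem_univ _) (duplicate_injOn n)

theorem card_lt_runLen_mul_le {n : ℕ} (a : Fin n) (k : ℕ) :
    (univ.filter fun x : Fin n → Bool => k < runLen n x a).card * 2 ^ k ≤ 2 ^ n := by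
  by_cases hk : a.val + k < n
  · let T : Finset (Fin n) := Ioc a ⟨a.val + k, hk⟩
    have hT : T.card = k := by simp [T]
    have hinj : (univ.filter fun x : Fin n → Bool => k < runLen n x a).card ≤
        (univ : Finset ({i // i ∉ T} → Bool)).card := by
      refine card_le_card_of_injOn (fun x i => x i) (fun _ _ => mem_univ _) ?_
      intro x hx y hy h
      simp only [coe_filter, mem_univ, true_and, Set.mem_ofPred_eq, lt_runLen_iff] at hx hy
      have hout : ∀ i ∉ T, x i = y i := fun i hi => congrFun h ⟨i, hi⟩
      funext i
      by_cases hi : i ∈ T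
      · simp only [T, mem_Ioc] at hi
        rw [hx.2 i hi.1.le hi.2, hy.2 i hi.1.le hi.2]
        exact hout a (by simp [T])
      · exact hout i hi
    have hcard : (univ : Finset ({i // i ∉ T} → Bool)).card = 2 ^ (n - k) := by
      simp [Fintype.card_subtype_compl, hT]
    calc _ ≤ 2 ^ (n - k) * 2 ^ k := Nat.mul_le_mul_right _ (hcard ▸ hinj)
      _ = 2 ^ n := by rw [← pow_add, Nat.sub_add_cancel (by omega)]
  · have : (univ.filter fun x : Fin n → Bool => k < runLen n x a) = ∅ :=
      filter_eq_empty_iff.2 fun x _ h => hk ((lt_runLen_iff x a k).1 h).1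
    simp [this]

theorem sum_maxRun_mul_numRuns_le {n k : ℕ} (hk : n ^ 2 ≤ 2 ^ k) :
    ∑ x : Fin n → Bool, maxRun n x * numRuns n x (maxRun n x) ≤ (2 * k + 1) * 2 ^ n := by
  have hpairs : ∑ x : Fin n → Bool, maxRun n x * numRuns n x (maxRun n x) ≤
      ∑ p ∈ longestRunPairs n, runLen n p.1 p.2 := by
    rw [longestRunPairs, sum_filter, ← univ_product_univ, sum_product]
    refine sum_le_sum fun x _ => ?_
    rw [← sum_filter, sum_congr rfl fun a ha => (mem_filter.1 ha).2]
    dsimp only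
    rw [sum_const, smul_eq_mul, mul_comm]
    exact Nat.mul_le_mul_right _ (card_le_card (filter_subset_filter _ (subset_univ _)))
  have hsplit : ∀ p : (Fin n → Bool) × Fin n,
      runLen n p.1 p.2 ≤ k + if k < runLen n p.1 p.2 then n else 0 := by
    intro p
    have := add_runLen_le p.1 p.2
    split_ifs <;> omega
  have htail : (∑ p : (Fin n → Bool) × Fin n, if k < runLen n p.1 p.2 then n else 0) ≤ 2 ^ n := by
    rw [← univ_product_univ, sum_product_right]
    refine Nat.le_of_mul_le_mul_right ?_ (Nat.two_pow_pos k)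
    calc _ = ∑ a : Fin n,
          n * ((univ.filter fun x : Fin n → Bool => k < runLen n x a).card * 2 ^ k) := by
          rw [sum_mul]
          refine sum_congr rfl fun a _ => ?_
          rw [← sum_filter, sum_const, smul_eq_mul]
          ring
      _ ≤ ∑ _a : Fin n, n * 2 ^ n :=
          sum_le_sum fun a _ => Nat.mul_le_mul_left _ (card_lt_runLen_mul_le a k)
      _ = 2 ^ n * n ^ 2 := by
          rw [sum_const, card_univ, Fintype.card_fin, smul_eq_mul]
          ring
      _ ≤ 2 ^ n * 2 ^ k := Nat.mul_le_mul_left _ hk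
  calc _ ≤ ∑ p ∈ longestRunPairs n, runLen n p.1 p.2 := hpairs
    _ ≤ ∑ p ∈ longestRunPairs n, (k + if k < runLen n p.1 p.2 then n else 0) :=
        sum_le_sum fun p _ => hsplit p
    _ = (longestRunPairs n).card * k +
          ∑ p ∈ longestRunPairs n, if k < runLen n p.1 p.2 then n else 0 := by
        rw [sum_add_distrib, sum_const, smul_eq_mul]
    _ ≤ 2 ^ (n + 1) * k + 2 ^ n :=
        add_le_add (Nat.mul_le_mul_right _ (card_longestRunPairs_le n))
          ((sum_le_sum_of_subset (subset_univ _)).trans htail)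
    _ = (2 * k + 1) * 2 ^ n := by ring

/-- **Key influence estimate for CycleRun.** There is a universal `C > 0` such that for every
`n ≥ 2`, `E_x[ℓ(x)·r_{ℓ(x)}(x)] ≤ C·log n` for `x` uniform on `{-1,1}^n`. -/
theorem stmt15 :
    ∃ C : ℝ, 0 < C ∧
      ∀ n : ℕ, 2 ≤ n →
        expect (fun x : Fin n → Bool =>
            (maxRun n x : ℝ) * (numRuns n x (maxRun n x) : ℝ)) ≤
          C * Real.log n := by
  have hlog2 : 0 < Real.log 2 := Real.log_pos one_lt_two
  refine ⟨9 / Real.log 2, by positivity, fun n hn => ?_⟩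
  set L := Nat.log 2 n
  have hk : n ^ 2 ≤ 2 ^ (2 * (L + 1)) := by
    rw [mul_comm, pow_mul]
    exact Nat.pow_le_pow_left (Nat.lt_pow_succ_log_self one_lt_two n).le 2
  have hsum : (∑ x : Fin n → Bool, (maxRun n x : ℝ) * (numRuns n x (maxRun n x) : ℝ)) ≤
      (4 * L + 5) * 2 ^ n := by
    have := sum_maxRun_mul_numRuns_le hk
    calc _ = ((∑ x : Fin n → Bool, maxRun n x * numRuns n x (maxRun n x) : ℕ) : ℝ) := by
          push_cast
          rfl
      _ ≤ (((2 * (2 * (L + 1)) + 1) * 2 ^ n : ℕ) : ℝ) := by exact_mod_cast this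
      _ = (4 * L + 5) * 2 ^ n := by
          push_cast
          ring
  have hL1 : (1 : ℝ) ≤ L := by
    exact_mod_cast Nat.log_pos one_lt_two hn
  have hL : L * Real.log 2 ≤ Real.log n := by
    rw [← Real.log_pow]
    refine Real.log_le_log (by positivity) ?_
    exact_mod_cast Nat.pow_log_le_self 2 (by omega)
  rw [_root_.expect, Fintype.card_fin, div_le_iff₀ (by positivity)]
  refine hsum.trans (mul_le_mul_of_nonneg_right ?_ (by positivity))
  rw [div_mul_eq_mul_div, le_div_iff₀ hlog2]
  nlinarith
end
end

section
/- There exists n₀ such that for every n ≥ n₀ and every integer t ≥ 1, Pr_x[ℓ(x) ≤ t] ≤ (1 − 2^{−t})^{n/8} + exp(−n/32), where x is uniform on {-1,1}^n. -/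
open Finset

noncomputable section

/-- `l` has no `t + 1` consecutive equal entries. -/
def RunsLE (t : ℕ) (l : List Bool) : Prop := ∀ b, ¬ List.replicate (t + 1) b <:+: l

lemma runsLE_cons {t : ℕ} {c : Bool} {l : List Bool} :
    RunsLE t (c :: l) ↔ (∀ b, ¬ List.replicate (t + 1) b <+: c :: l) ∧ RunsLE t l := by
  simp only [RunsLE, List.infix_cons_iff, not_or, forall_and]

lemma RunsLE.replicate_append {t : ℕ} {c : Bool} {l : List Bool} (h : RunsLE t (c :: l))
    {s : ℕ} (hs : s ≤ t) : RunsLE t (List.replicate s (!c) ++ c :: l) := by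
  induction s with
  | zero => simpa using h
  | succ s ih =>
    rw [List.replicate_succ, List.cons_append, runsLE_cons]
    refine ⟨fun b hb => ?_, ih (by omega)⟩
    rw [← List.cons_append, ← List.replicate_succ] at hb
    have key : ∀ i ≤ t, (List.replicate (s + 1) (!c) ++ c :: l)[i]? = some b := by
      intro i hi
      obtain ⟨r, hr⟩ := hb
      rw [← hr, List.getElem?_append_left (by simp; omega)]
      simp [List.getElem?_replicate]; omega
    have h0 := key 0 (by omega)
    have h1 := key (s + 1) hs
    rw [List.getElem?_append_left (by simp)] at h0
    rw [List.getElem?_append_right (by simp)] at h1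
    simp at h0 h1
    rw [h1] at h0
    cases b <;> simp at h0

open Classical in
/-- The Boolean words of length `n` without `t + 1` consecutive equal entries. -/
def shortRunWords (t n : ℕ) : Finset (List Bool) :=
  ((univ : Finset (Fin n → Bool)).image List.ofFn).filter (RunsLE t)

lemma mem_shortRunWords {t n : ℕ} {l : List Bool} :
    l ∈ shortRunWords t n ↔ l.length = n ∧ RunsLE t l := by
  simp only [shortRunWords, mem_filter, mem_image, mem_univ, true_and]
  refine and_congr_left fun _ => ⟨?_, ?_⟩
  · rintro ⟨x, rfl⟩
    simp
  · rintro rfl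
    exact ⟨l.get, List.ofFn_get l⟩

/-- The words of length `n + 1` whose tail has no `t + 1` consecutive equal entries. -/
def consShortRunWords (t n : ℕ) : Finset (List Bool) :=
  ((univ : Finset Bool) ×ˢ shortRunWords t n).image fun p => p.1 :: p.2

lemma card_consShortRunWords_le (t n : ℕ) :
    (consShortRunWords t n).card ≤ 2 * (shortRunWords t n).card :=
  card_image_le.trans (by simp [card_product])

lemma cons_mem_consShortRunWords {t n : ℕ} {c : Bool} {l : List Bool}
    (hl : l ∈ shortRunWords t n) : c :: l ∈ consShortRunWords t n :=
  mem_image.2 ⟨(c, l), by simpa using hl, rfl⟩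

lemma shortRunWords_succ_subset (t n : ℕ) :
    shortRunWords t (n + 1) ⊆ consShortRunWords t n := by
  intro l hl
  rw [mem_shortRunWords] at hl
  obtain ⟨hlen, hl⟩ := hl
  cases l with
  | nil => simp at hlen
  | cons c l =>
    exact cons_mem_consShortRunWords
      (mem_shortRunWords.2 ⟨by simpa using hlen, (runsLE_cons.1 hl).2⟩)

lemma card_shortRunWords_add_le (t m s : ℕ) :
    (shortRunWords t (m + s)).card ≤ 2 ^ s * (shortRunWords t m).card := by
  induction s with
  | zero => simp
  | succ s ih =>
    calc (shortRunWords t (m + s + 1)).card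
        ≤ 2 * (shortRunWords t (m + s)).card :=
          (card_le_card (shortRunWords_succ_subset t _)).trans (card_consShortRunWords_le t _)
      _ ≤ 2 * (2 ^ s * (shortRunWords t m).card) := by gcongr
      _ = 2 ^ (s + 1) * (shortRunWords t m).card := by ring

/-- Prefixing a word that starts with `c` by `t + 1` copies of `!c` leaves the set of words with
short runs, although the tail of the resulting word still has short runs. -/
lemma card_shortRunWords_succ_add_le (t m : ℕ) :
    (shortRunWords t (m + 1 + t + 1)).card + (shortRunWords t (m + 1)).card ≤
      2 * (shortRunWords t (m + 1 + t)).card := by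
  classical
  let φ : List Bool → List Bool := fun l => List.replicate (t + 1) (!l.headD false) ++ l
  have hφ : Function.Injective φ := fun l l' h => by
    simpa [φ] using congrArg (List.drop (t + 1)) h
  rw [← card_image_of_injective (shortRunWords t (m + 1)) hφ, ← card_union_of_disjoint]
  · refine (card_le_card (union_subset (shortRunWords_succ_subset t _) ?_)).trans
      (card_consShortRunWords_le t _)
    intro w hw
    obtain ⟨l, hl, rfl⟩ := mem_image.1 hw
    obtain ⟨hlen, hl⟩ := mem_shortRunWords.1 hl
    cases l with
    | nil => simp at hlen
    | cons c l =>
      simp only [φ, List.headD_cons, List.replicate_succ, List.cons_append]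
      refine cons_mem_consShortRunWords (mem_shortRunWords.2 ⟨?_, hl.replicate_append le_rfl⟩)
      simp at hlen ⊢
      omega
  · rw [disjoint_left]
    intro w hw hw'
    obtain ⟨l, -, rfl⟩ := mem_image.1 hw'
    exact (mem_shortRunWords.1 hw).2 _ (List.prefix_append _ _).isInfix

lemma card_shortRunWords_le_pow (t k : ℕ) :
    ((shortRunWords t (t + 1 + k)).card : ℝ) ≤
      2 ^ (t + 1 + k) * (1 - (1 / 2) ^ t / 2) ^ k := by
  induction k with
  | zero =>
    have h := card_shortRunWords_add_le t 0 (t + 1)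
    have h0 : (shortRunWords t 0).card ≤ 1 := by
      rw [card_le_one]
      intro l hl l' hl'
      rw [List.eq_nil_of_length_eq_zero (mem_shortRunWords.1 hl).1,
        List.eq_nil_of_length_eq_zero (mem_shortRunWords.1 hl').1]
    have : (shortRunWords t (t + 1)).card ≤ 2 ^ (t + 1) := by
      rw [zero_add] at h
      exact h.trans (mul_le_of_le_one_right' h0)
    simpa using (by exact_mod_cast this : ((shortRunWords t (t + 1)).card : ℝ) ≤ 2 ^ (t + 1))
  | succ k ih =>
    have h1 := card_shortRunWords_succ_add_le t k
    have h2 := card_shortRunWords_add_le t (k + 1) t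
    rw [show k + 1 + t = t + 1 + k by ring] at h1 h2
    have h1' : ((shortRunWords t (t + 1 + k + 1)).card : ℝ) + (shortRunWords t (k + 1)).card ≤
      2 * (shortRunWords t (t + 1 + k)).card := by exact_mod_cast h1
    have h2' : ((shortRunWords t (t + 1 + k)).card : ℝ) ≤
      2 ^ t * (shortRunWords t (k + 1)).card := by exact_mod_cast h2
    have hq : (1 / 2 : ℝ) ^ t * 2 ^ t = 1 := by rw [← mul_pow]; norm_num
    have hq0 : (0 : ℝ) < (1 / 2) ^ t := by positivity
    have hq1 : (1 / 2 : ℝ) ^ t ≤ 1 := pow_le_one₀ (by norm_num) (by norm_num)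
    have h3 : (1 / 2 : ℝ) ^ t * (shortRunWords t (t + 1 + k)).card ≤
        (shortRunWords t (k + 1)).card := by
      calc _ ≤ (1 / 2 : ℝ) ^ t * (2 ^ t * (shortRunWords t (k + 1)).card) := by gcongr
        _ = _ := by rw [← mul_assoc, hq, one_mul]
    have h4 := mul_le_mul_of_nonneg_left ih
      (by linarith : 0 ≤ 2 * (1 - (1 / 2 : ℝ) ^ t / 2))
    calc ((shortRunWords t (t + 1 + (k + 1))).card : ℝ)
        ≤ 2 * (1 - (1 / 2 : ℝ) ^ t / 2) * (shortRunWords t (t + 1 + k)).card := by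
          rw [← add_assoc]; linarith
      _ ≤ _ := h4
      _ = _ := by ring

/-- A window of equal coordinates is contained in a run. -/
lemma lt_maxRun_of_window {n t : ℕ} {x : Fin n → Bool} {b : Bool} {a : ℕ} (hn : a + t < n)
    (h : ∀ k : Fin n, a ≤ k → k ≤ a + t → x k = b) : t < maxRun n x := by
  classical
  have hex : ∃ c, c ≤ a ∧ ∀ k : Fin n, c ≤ k → k ≤ a + t → x k = b := ⟨a, le_rfl, h⟩
  obtain ⟨hca, hc⟩ := Nat.find_spec hex
  set c := Nat.find hex
  have hxc : x ⟨c, by omega⟩ = b := hc _ le_rfl (by simp; omega)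
  have hstart : (⟨c, by omega⟩ : Fin n) ∈ runStarts n x := by
    simp only [runStarts, mem_filter, mem_univ, true_and]
    by_contra! hcon
    obtain ⟨hc0, heq⟩ := hcon
    refine Nat.find_min hex (m := c - 1) (by omega) ⟨by omega, fun k hk hk' => ?_⟩
    rcases Nat.lt_or_ge k.val c with hkc | hkc
    · have : k = ⟨c - 1, by omega⟩ := Fin.ext (by simp; omega)
      rw [this, ← heq, hxc]
    · exact hc k hkc hk'
  refine lt_of_lt_of_le ?_ (Finset.le_sup (f := runLen n x) hstart)
  have hsub : Finset.Icc (⟨c, by omega⟩ : Fin n) ⟨a + t, hn⟩ ⊆ univ.filter (fun j : Fin n =>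
      (⟨c, by omega⟩ : Fin n) ≤ j ∧
        ∀ k : Fin n, (⟨c, by omega⟩ : Fin n) ≤ k → k ≤ j → x k = x ⟨c, by omega⟩) := by
    intro j hj
    simp only [Finset.mem_Icc, Fin.le_def] at hj
    simp only [mem_filter, mem_univ, true_and, Fin.le_def]
    exact ⟨hj.1, fun k hk hkj => (hc k hk (hkj.trans hj.2)).trans hxc.symm⟩
  have hcard := card_le_card hsub
  rw [Fin.card_Icc] at hcard
  simp only [runLen]
  simp only at hcard
  omega

lemma runsLE_ofFn {n t : ℕ} {x : Fin n → Bool} (hx : maxRun n x ≤ t) :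
    RunsLE t (List.ofFn x) := by
  rintro b ⟨l, r, h⟩
  have hlen := congrArg List.length h
  simp at hlen
  refine absurd (lt_maxRun_of_window (b := b) (a := l.length) (t := t) (x := x) (by omega) ?_)
    (not_lt.2 hx)
  intro k hk hk'
  have h1 : (List.ofFn x)[k.val]? = some b := by
    rw [← h, List.getElem?_append_left (by simp; omega), List.getElem?_append_right hk,
      List.getElem?_replicate, if_pos (by omega)]
  simpa using h1

lemma expect_maxRun_le_card (n t : ℕ) :
    expect (fun x : Fin n → Bool => if maxRun n x ≤ t then (1 : ℝ) else 0) ≤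
      (shortRunWords t n).card / 2 ^ n := by
  rw [_root_.expect, Fintype.card_fin, sum_boole]
  gcongr
  refine card_le_card_of_injOn List.ofFn (fun x hx => ?_) List.ofFn_injective.injOn
  rw [mem_coe, mem_filter] at hx
  exact mem_shortRunWords.2 ⟨by simp, runsLE_ofFn hx.2⟩

lemma expect_maxRun_le_one (n t : ℕ) :
    expect (fun x : Fin n → Bool => if maxRun n x ≤ t then (1 : ℝ) else 0) ≤ 1 := by
  rw [_root_.expect, Fintype.card_fin, sum_boole, div_le_one (by positivity)]
  exact_mod_cast (card_filter_le _ _).trans (by simp)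

lemma expect_maxRun_le_pow {n t : ℕ} (h : t < n) :
    expect (fun x : Fin n → Bool => if maxRun n x ≤ t then (1 : ℝ) else 0) ≤
      (1 - (1 / 2) ^ t / 2) ^ (n - t - 1) := by
  refine (expect_maxRun_le_card n t).trans ?_
  rw [div_le_iff₀ (by positivity), mul_comm]
  have := card_shortRunWords_le_pow t (n - t - 1)
  rwa [show t + 1 + (n - t - 1) = n by omega] at this

/-- For `t ≤ n / 2` the first term already dominates. -/
lemma one_sub_half_pow_le_rpow {n t : ℕ} (hn : 8 ≤ n) (ht : 1 ≤ t) (htn : 2 * t ≤ n) :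
    (1 - (1 / 2 : ℝ) ^ t / 2) ^ (n - t - 1) ≤ (1 - (1 / 2) ^ t) ^ ((n : ℝ) / 8) := by
  set q : ℝ := (1 / 2) ^ t with hq
  have hq0 : 0 < q := by positivity
  have hq1 : q ≤ 1 / 2 := by
    rw [hq]
    exact pow_le_of_le_one (by norm_num) (by norm_num) (by omega)
  have hcube : (1 - q / 2) ^ 3 ≤ 1 - q := by nlinarith [mul_pos hq0 hq0]
  have hroot : 1 - q / 2 ≤ (1 - q) ^ (1 / 3 : ℝ) := by
    rw [one_div, Real.le_rpow_inv_iff_of_pos (by linarith) (by linarith) (by norm_num)]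
    exact_mod_cast hcube
  calc (1 - q / 2) ^ (n - t - 1) ≤ ((1 - q) ^ (1 / 3 : ℝ)) ^ (n - t - 1) :=
        pow_le_pow_left₀ (by linarith) hroot _
    _ = (1 - q) ^ ((1 / 3 : ℝ) * (n - t - 1 : ℕ)) := by
        rw [Real.rpow_mul (by linarith), Real.rpow_natCast]
    _ ≤ _ := by
        refine Real.rpow_le_rpow_of_exponent_ge (by linarith) (by linarith) ?_
        have h1 : (n : ℝ) = (n - t - 1 : ℕ) + t + 1 := by
          exact_mod_cast (by omega : n = n - t - 1 + t + 1)
        have h2 : (2 * t : ℝ) ≤ n := by exact_mod_cast htn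
        have h3 : (8 : ℝ) ≤ n := by exact_mod_cast hn
        linarith

/-- For `t > n / 2` the right-hand side exceeds `1`. -/
lemma one_le_rpow_add_exp {n t : ℕ} (hn : 8 ≤ n) (htn : n < 2 * t) :
    1 ≤ (1 - (1 / 2 : ℝ) ^ t) ^ ((n : ℝ) / 8) + Real.exp (-(n : ℝ) / 32) := by
  have hn' : (8 : ℝ) ≤ n := by exact_mod_cast hn
  have htn' : (n : ℝ) < 2 * t := by exact_mod_cast htn
  have hq1 : (1 / 2 : ℝ) ^ t ≤ 1 := pow_le_one₀ (by norm_num) (by norm_num)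
  have hbern := one_add_mul_self_le_rpow_one_add (s := -(1 / 2 : ℝ) ^ t) (by linarith)
    (p := (n : ℝ) / 8) (by linarith)
  rw [← sub_eq_add_neg] at hbern
  have hpow : (1 / 2 : ℝ) ^ t = Real.exp (-(t * Real.log 2)) := by
    rw [Real.exp_neg, mul_comm, Real.exp_mul, Real.exp_log (by norm_num), Real.rpow_natCast]
    simp
  have hlin : (n : ℝ) / 8 ≤ Real.exp (n / 8) := by linarith [Real.add_one_le_exp ((n : ℝ) / 8)]
  have hsmall : (n : ℝ) / 8 * (1 / 2) ^ t ≤ Real.exp (-(n : ℝ) / 32) := by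
    calc (n : ℝ) / 8 * (1 / 2) ^ t ≤ Real.exp (n / 8) * (1 / 2) ^ t := by gcongr
      _ = Real.exp (n / 8 - t * Real.log 2) := by rw [hpow, ← Real.exp_add, sub_eq_add_neg]
      _ ≤ _ := by
        rw [Real.exp_le_exp]
        nlinarith [Real.log_two_gt_d9]
  linarith

/-- **Longest-run lower tail.** There is `n₀` such that for every `n ≥ n₀` and every integer
`t ≥ 1`, `Pr_x[ℓ(x) ≤ t] ≤ (1 − 2^{−t})^{n/8} + exp(−n/32)` for `x` uniform on `{-1,1}^n`. -/
theorem stmt16 :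
    ∃ n₀ : ℕ, ∀ n : ℕ, n₀ ≤ n → ∀ t : ℕ, 1 ≤ t →
      expect (fun x : Fin n → Bool => if maxRun n x ≤ t then (1 : ℝ) else 0) ≤
        (1 - 2 ^ (-(t : ℝ))) ^ ((n : ℝ) / 8) + Real.exp (-(n : ℝ) / 32) := by
  refine ⟨8, fun n hn t ht => ?_⟩
  have hq : (2 : ℝ) ^ (-(t : ℝ)) = (1 / 2) ^ t := by
    rw [Real.rpow_neg (by norm_num), Real.rpow_natCast]
    simp
  rw [hq]
  rcases le_or_gt (2 * t) n with htn | htn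
  · exact (expect_maxRun_le_pow (by omega)).trans ((one_sub_half_pow_le_rpow hn ht htn).trans
      (le_add_of_nonneg_right (Real.exp_pos _).le))
  · exact (expect_maxRun_le_one n t).trans (one_le_rpow_add_exp hn htn)
end
end

section
/- For every n ≥ 1 and every integer t with 1 ≤ t ≤ n, one has E_x[ℓ(x)·r_{ℓ(x)}(x) | ℓ(x) = t] ≤ t·(2^{1−t}·n + 1), where x is uniform on {-1,1}^n (the conditioning event has positive probability for every such t). -/
open Finset

noncomputable section

theorem le_runLen_iff {n : ℕ} (x : Fin n → Bool) (a : Fin n) (k : ℕ) :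
    k ≤ runLen n x a ↔
      a.val + k ≤ n ∧ ∀ j : Fin n, a ≤ j → j.val < a.val + k → x j = x a := by
  unfold runLen
  constructor
  · intro h
    constructor
    · have hsub : (Finset.univ.filter (fun j : Fin n =>
          a ≤ j ∧ ∀ k : Fin n, a ≤ k → k ≤ j → x k = x a)) ⊆ Finset.Ici a := by
        intro j hj
        simp only [mem_filter, mem_univ, true_and] at hj
        exact Finset.mem_Ici.2 hj.1
      have hcard := Finset.card_le_card hsub
      rw [Fin.card_Ici] at hcard
      have := a.isLt
      omega
    · intro j haj hjk
      by_contra hne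
      have hsub : (Finset.univ.filter (fun j : Fin n =>
          a ≤ j ∧ ∀ k : Fin n, a ≤ k → k ≤ j → x k = x a)) ⊆ Finset.Ico a j := by
        intro i hi
        simp only [mem_filter, mem_univ, true_and] at hi
        refine Finset.mem_Ico.2 ⟨hi.1, ?_⟩
        by_contra hji
        exact hne (hi.2 j haj (not_lt.1 hji))
      have hcard := Finset.card_le_card hsub
      rw [Fin.card_Ico] at hcard
      have : a.val ≤ j.val := haj
      omega
  · rintro ⟨hk, hx⟩
    have hsub : (Finset.univ : Finset (Fin k)).image
        (fun i : Fin k => (⟨a.val + i.val, by omega⟩ : Fin n)) ⊆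
        Finset.univ.filter (fun j : Fin n =>
          a ≤ j ∧ ∀ k : Fin n, a ≤ k → k ≤ j → x k = x a) := by
      intro j hj
      obtain ⟨i, -, rfl⟩ := Finset.mem_image.1 hj
      simp only [mem_filter, mem_univ, true_and]
      refine ⟨Fin.le_def.2 (by simp), fun l hal hl => hx l hal ?_⟩
      have := Fin.le_def.1 hl
      simp only at this
      omega
    have hcard := Finset.card_le_card hsub
    rw [Finset.card_image_of_injective _ (fun i j hij => by
      simp only [Fin.mk.injEq] at hij
      exact Fin.ext (by omega)), Finset.card_univ, Fintype.card_fin] at hcard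
    exact hcard

theorem maxRun_le_iff {n : ℕ} (x : Fin n → Bool) (t : ℕ) :
    maxRun n x ≤ t ↔
      ∀ c : Fin n, c.val + t < n →
        ∃ j : Fin n, c ≤ j ∧ j.val ≤ c.val + t ∧ x j ≠ x c := by
  constructor
  · intro h c hc
    by_contra! hcon
    have : t + 1 ≤ runLen n x c :=
      (le_runLen_iff x c _).2 ⟨by omega, fun j hj hlt => hcon j hj (by omega)⟩
    have := runLen_le_maxRun x c
    omega
  · intro h
    refine Finset.sup_le fun c _ => ?_
    by_contra! hlt
    obtain ⟨h1, h2⟩ := (le_runLen_iff x c (t + 1)).1 hlt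
    obtain ⟨j, hj, hjt, hne⟩ := h c (by omega)
    exact hne (h2 j hj (by omega))

theorem exists_maxRun_eq {n t : ℕ} (ht1 : 1 ≤ t) (htn : t ≤ n) :
    ∃ x : Fin n → Bool, maxRun n x = t := by
  refine ⟨fun i => decide (i.val < t ∨ (i.val - t) % 2 = 1), le_antisymm ?_ ?_⟩
  · rw [maxRun_le_iff]
    intro c hc
    by_contra! hcon
    have h1 := hcon ⟨c.val + t, hc⟩ (Fin.le_def.2 (by simp)) le_rfl
    have h2 := hcon ⟨c.val + t - 1, by omega⟩ (Fin.le_def.2 (by simp only; omega))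
      (by simp only; omega)
    rw [← h2] at h1
    simp only [decide_eq_decide] at h1
    omega
  · refine le_trans ?_ (runLen_le_maxRun _ ⟨0, by omega⟩)
    refine (le_runLen_iff _ _ _).2 ⟨by simpa using htn, fun j _ hj => ?_⟩
    simp only [decide_eq_decide]
    simp only at hj
    omega

/-- The string obtained from `x` by flipping every position `i` with `min i e ∈ W`. -/
def flipUpTo {n : ℕ} (x : Fin n → Bool) (e : ℕ) (W : Finset ℕ) : Fin n → Bool :=
  fun i => xor (x i) (decide (min i.val e ∈ W))

/-- The strings with longest run of length `t` in which a run of length `t` starts at `a` and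
another one starts before `a`. -/
def laterLongestRun (n t : ℕ) (a : Fin n) : Finset (Fin n → Bool) :=
  Finset.univ.filter fun x => maxRun n x = t ∧ a ∈ runStarts n x ∧ runLen n x a = t ∧
    ∃ b, b < a ∧ b ∈ runStarts n x ∧ runLen n x b = t

theorem maxRun_flipUpTo {n t : ℕ} (ht1 : 1 ≤ t) {a : Fin n} {x : Fin n → Bool}
    (hx : x ∈ laterLongestRun n t a) {W : Finset ℕ}
    (hW : W ⊆ Finset.Ioc a.val (a.val + t - 1)) :
    maxRun n (flipUpTo x (a.val + t - 1) W) = t := by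
  simp only [laterLongestRun, mem_filter, mem_univ, true_and] at hx
  obtain ⟨hmax, ha, hat, b, hba, hb, hbt⟩ := hx
  have hba' : b.val < a.val := hba
  have hle : ∀ i : Fin n, i ≤ a → flipUpTo x (a.val + t - 1) W i = x i := by
    intro i hi
    have : min i.val (a.val + t - 1) ∉ W := by
      intro hmem
      have := Finset.mem_Ioc.1 (hW hmem)
      have := Fin.le_def.1 hi
      omega
    simp [flipUpTo, this]
  have hge : ∀ i j : Fin n, a.val + t - 1 ≤ i.val → a.val + t - 1 ≤ j.val →
      (flipUpTo x (a.val + t - 1) W i = flipUpTo x (a.val + t - 1) W j ↔ x i = x j) := by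
    intro i j hi hj
    simp only [flipUpTo, min_eq_right hi, min_eq_right hj]
    exact Bool.xor_left_inj
  obtain ⟨hbn, hbc⟩ := (le_runLen_iff x b t).1 hbt.ge
  obtain ⟨han, hac⟩ := (le_runLen_iff x a t).1 hat.ge
  have hprev : x a ≠ x ⟨a.val - 1, by omega⟩ := by
    simp only [runStarts, mem_filter, mem_univ, true_and] at ha
    exact ha.resolve_left (by omega)
  have hnext : ∀ h : a.val + t < n, x ⟨a.val + t, h⟩ ≠ x a := by
    intro h heq
    have : t + 1 ≤ runLen n x a := (le_runLen_iff x a _).2 ⟨by omega, fun j hj hlt => by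
      rcases Nat.lt_or_ge j.val (a.val + t) with h' | h'
      · exact hac j hj h'
      · rw [← heq]
        exact congrArg x (Fin.ext (by simp only; omega))⟩
    omega
  have hbta : b.val + t ≤ a.val := by
    by_contra! h
    apply hprev
    rw [hbc a hba.le h, hbc ⟨a.val - 1, by omega⟩ (Fin.le_def.2 (by simp only; omega))
      (by simp only; omega)]
  apply le_antisymm
  · rw [maxRun_le_iff]
    intro c hc
    by_contra! hcon
    obtain ⟨j, hj, hjt, hne⟩ := (maxRun_le_iff x t).1 hmax.le c hc
    have hcj := Fin.le_def.1 hj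
    rcases Nat.lt_or_ge c.val a.val with hca | hca
    · rcases Nat.lt_or_ge (c.val + t) a.val with hcta | hcta
      · apply hne
        rw [← hle j (Fin.le_def.2 (by omega)), ← hle c (Fin.le_def.2 (by omega))]
        exact hcon j hj hjt
      · apply hprev
        rw [← hle a le_rfl, ← hle ⟨a.val - 1, by omega⟩ (Fin.le_def.2 (by simp only; omega)),
          hcon a (Fin.le_def.2 hca.le) hcta,
          hcon ⟨a.val - 1, by omega⟩ (Fin.le_def.2 (by simp only; omega)) (by simp only; omega)]
    · rcases Nat.lt_or_ge c.val (a.val + t) with hcta | hcta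
      · apply hnext (by omega)
        rw [← hac ⟨a.val + t - 1, by omega⟩ (Fin.le_def.2 (by simp only; omega))
          (by simp only; omega)]
        rw [← hge _ _ (by simp only; omega) (by simp only; omega)]
        rw [hcon ⟨a.val + t, by omega⟩ (Fin.le_def.2 (by simp only; omega)) (by simp only; omega),
          hcon ⟨a.val + t - 1, by omega⟩ (Fin.le_def.2 (by simp only; omega))
            (by simp only; omega)]
      · exact hne ((hge j c (by omega) (by omega)).1 (hcon j hj hjt))
  · refine le_trans ?_ (runLen_le_maxRun _ b)
    refine (le_runLen_iff _ _ _).2 ⟨hbn, fun j hj hjt => ?_⟩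
    rw [hle j (Fin.le_def.2 (by omega)), hle b hba.le]
    exact hbc j hj hjt

theorem card_laterLongestRun_mul_le {n t : ℕ} (ht1 : 1 ≤ t) (a : Fin n) :
    (laterLongestRun n t a).card * 2 ^ (t - 1) ≤
      (Finset.univ.filter (fun x : Fin n → Bool => maxRun n x = t)).card := by
  have hcard : (Finset.Ioc a.val (a.val + t - 1)).powerset.card = 2 ^ (t - 1) := by
    rw [Finset.card_powerset, Nat.card_Ioc]
    congr 1
    omega
  rw [← hcard, ← Finset.card_product]
  refine Finset.card_le_card_of_injOn (fun p => flipUpTo p.1 (a.val + t - 1) p.2) ?_ ?_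
  · rintro ⟨x, W⟩ hp
    obtain ⟨hx, hW⟩ := Finset.mem_product.1 (Finset.mem_coe.1 hp)
    simp only [Finset.mem_powerset] at hW
    simpa using maxRun_flipUpTo ht1 hx hW
  · rintro ⟨x, W⟩ hp ⟨x', W'⟩ hp' heq
    obtain ⟨hx, hW⟩ := Finset.mem_product.1 (Finset.mem_coe.1 hp)
    obtain ⟨hx', hW'⟩ := Finset.mem_product.1 (Finset.mem_coe.1 hp')
    simp only [Finset.mem_powerset] at hx hW hx' hW'
    simp only [laterLongestRun, mem_filter, mem_univ, true_and] at hx hx'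
    obtain ⟨hn, hc⟩ := (le_runLen_iff x a t).1 hx.2.2.1.ge
    obtain ⟨-, hc'⟩ := (le_runLen_iff x' a t).1 hx'.2.2.1.ge
    have hpt : ∀ i : Fin n, xor (x i) (decide (min i.val (a.val + t - 1) ∈ W)) =
        xor (x' i) (decide (min i.val (a.val + t - 1) ∈ W')) := fun i => congrFun heq i
    have haW : ∀ V ⊆ Finset.Ioc a.val (a.val + t - 1), min a.val (a.val + t - 1) ∉ V := by
      intro V hV hmem
      have := Finset.mem_Ioc.1 (hV hmem)
      omega
    have hxa : x a = x' a := by simpa [haW W hW, haW W' hW'] using hpt a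
    have hWW : W = W' := by
      ext k
      by_cases hk : k ∈ Finset.Ioc a.val (a.val + t - 1)
      · have hk' := Finset.mem_Ioc.1 hk
        have h := hpt ⟨k, by omega⟩
        rw [hc ⟨k, by omega⟩ (Fin.le_def.2 hk'.1.le) (by simp only; omega),
          hc' ⟨k, by omega⟩ (Fin.le_def.2 hk'.1.le) (by simp only; omega), hxa,
          Bool.xor_right_inj] at h
        simpa [min_eq_left hk'.2] using h
      · exact iff_of_false (fun h => hk (hW h)) (fun h => hk (hW' h))
    subst hWW
    refine Prod.ext (funext fun i => ?_) rfl
    exact Bool.xor_left_inj.1 (hpt i)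

theorem numRuns_le {n t : ℕ} {x : Fin n → Bool} (hx : maxRun n x = t) :
    numRuns n x t ≤ (Finset.univ.filter fun a => x ∈ laterLongestRun n t a).card + 1 := by
  unfold numRuns
  rcases ((runStarts n x).filter (fun a => runLen n x a = t)).eq_empty_or_nonempty with h | h
  · simp [h]
  · rw [← Nat.sub_le_iff_le_add, ← Finset.card_erase_of_mem (Finset.min'_mem _ h)]
    refine Finset.card_le_card fun a ha => ?_
    have hlt := Finset.min'_lt_of_mem_erase_min' _ h ha
    have hmin := Finset.mem_filter.1 (Finset.min'_mem _ h)
    have ha' := Finset.mem_filter.1 (Finset.mem_of_mem_erase ha)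
    simp only [laterLongestRun, mem_filter, mem_univ, true_and]
    exact ⟨hx, ha'.1, ha'.2, _, hlt, hmin.1, hmin.2⟩

theorem sum_numRuns_mul_le {n t : ℕ} (ht1 : 1 ≤ t) :
    (∑ x ∈ Finset.univ.filter (fun x : Fin n → Bool => maxRun n x = t), numRuns n x t) *
        2 ^ (t - 1) ≤
      (n + 2 ^ (t - 1)) * (Finset.univ.filter (fun x : Fin n → Bool => maxRun n x = t)).card := by
  set A := Finset.univ.filter (fun x : Fin n → Bool => maxRun n x = t) with hA
  have h1 : ∑ x ∈ A, numRuns n x t ≤ (∑ a : Fin n, (laterLongestRun n t a).card) + A.card := by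
    calc ∑ x ∈ A, numRuns n x t
        ≤ ∑ x ∈ A, ((Finset.univ.filter fun a => x ∈ laterLongestRun n t a).card + 1) :=
          Finset.sum_le_sum fun x hx => numRuns_le (Finset.mem_filter.1 hx).2
      _ = (∑ a : Fin n, (A.filter fun x => x ∈ laterLongestRun n t a).card) + A.card := by
          rw [Finset.sum_add_distrib, Finset.sum_const, smul_eq_mul, mul_one]
          congr 1
          exact Finset.sum_card_bipartiteAbove_eq_sum_card_bipartiteBelow _
      _ ≤ _ := by
          gcongr with a
          exact fun x hx => (Finset.mem_filter.1 hx).2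
  have h2 : (∑ a : Fin n, (laterLongestRun n t a).card) * 2 ^ (t - 1) ≤ n * A.card := by
    rw [Finset.sum_mul]
    refine (Finset.sum_le_sum fun a _ => card_laterLongestRun_mul_le ht1 a).trans ?_
    simp [hA]
  nlinarith [Nat.mul_le_mul_right (2 ^ (t - 1)) h1]

/-- **Conditional expectation of the number of maximal runs.** For every `n ≥ 1` and integer
`1 ≤ t ≤ n`, the event `{ℓ(x) = t}` is nonempty (has positive probability under the uniform
distribution), and `E_x[ℓ(x)·r_{ℓ(x)}(x) | ℓ(x) = t] ≤ t·(2^{1−t}·n + 1)`. -/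
theorem stmt17 (n : ℕ) (hn : 1 ≤ n) (t : ℕ) (ht1 : 1 ≤ t) (htn : t ≤ n) :
    (Finset.univ.filter (fun x : Fin n → Bool => maxRun n x = t)).Nonempty ∧
    (∑ x ∈ Finset.univ.filter (fun x : Fin n → Bool => maxRun n x = t),
          (maxRun n x : ℝ) * (numRuns n x (maxRun n x) : ℝ)) /
        ((Finset.univ.filter (fun x : Fin n → Bool => maxRun n x = t)).card : ℝ) ≤
      (t : ℝ) * ((2 : ℝ) ^ ((1 : ℝ) - (t : ℝ)) * (n : ℝ) + 1) := by
  have hne : (Finset.univ.filter (fun x : Fin n → Bool => maxRun n x = t)).Nonempty := by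
    obtain ⟨x, hx⟩ := exists_maxRun_eq ht1 htn
    exact ⟨x, by simpa using hx⟩
  refine ⟨hne, ?_⟩
  have hpos := Finset.card_pos.2 hne
  have hsum := sum_numRuns_mul_le (n := n) ht1
  have heq : (∑ x ∈ Finset.univ.filter (fun x : Fin n → Bool => maxRun n x = t),
      (maxRun n x : ℝ) * (numRuns n x (maxRun n x) : ℝ)) = (t : ℝ) *
      ((∑ x ∈ Finset.univ.filter (fun x : Fin n → Bool => maxRun n x = t), numRuns n x t : ℕ) :
        ℝ) := by
    rw [Nat.cast_sum, Finset.mul_sum]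
    refine Finset.sum_congr rfl fun x hx => ?_
    rw [(Finset.mem_filter.1 hx).2]
  have hpow : (2 : ℝ) ^ ((1 : ℝ) - (t : ℝ)) = ((2 : ℝ) ^ (t - 1))⁻¹ := by
    rw [← Real.rpow_natCast, ← Real.rpow_neg (by norm_num), Nat.cast_sub ht1]
    congr 1
    push_cast
    ring
  rw [heq, hpow]
  generalize (∑ x ∈ Finset.univ.filter (fun x : Fin n → Bool => maxRun n x = t),
    numRuns n x t) = s at *
  generalize (Finset.univ.filter (fun x : Fin n → Bool => maxRun n x = t)).card = m at *
  have hm : (0 : ℝ) < m := by exact_mod_cast hpos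
  have hs : (s : ℝ) * 2 ^ (t - 1) ≤ (n + 2 ^ (t - 1)) * m := by exact_mod_cast hsum
  rw [mul_div_assoc]
  refine mul_le_mul_of_nonneg_left ?_ (Nat.cast_nonneg t)
  have h2 : (0 : ℝ) < 2 ^ (t - 1) := by positivity
  rw [div_le_iff₀ hm]
  refine le_of_mul_le_mul_right (hs.trans_eq ?_) h2
  field_simp
end
end

section
/- Let f : {-1,1}^n → {-1,1} be monotone and odd, i.e., f(−x) = −f(x) for all x. Then for every integer k ≥ 1: (i) Σ_{x : x₁+⋯+xₙ = k} f(x) ≥ 0, i.e., at least half of the strings x with x₁+⋯+xₙ = k satisfy f(x) = 1; and (ii) Σ_{x : x₁+⋯+xₙ ≥ k} f(x) ≥ 0. -/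
open Finset

noncomputable section

/-- The coordinate sum `x₁ + ⋯ + xₙ ∈ ℤ` of a point of `{-1,1}^n`. -/
def coordSum {n : ℕ} (x : Fin n → Bool) : ℤ :=
  ∑ i : Fin n, (if x i then 1 else -1)

/-- If `x` has a nonnegative coordinate sum, some rearrangement of `x` dominates its negation. -/
theorem exists_perm_not_le {n : ℕ} {x : Fin n → Bool} (hx : 0 ≤ coordSum x) :
    ∃ τ : Equiv.Perm (Fin n), (fun i => !(x i)) ≤ fun i => x (τ i) := by
  have hcard : (univ.filter fun i => x i = false).card ≤ (univ.filter fun i => x i = true).card := by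
    have h : coordSum x = ((univ.filter fun i => x i = true).card : ℤ)
        - (univ.filter fun i => x i = false).card := by
      simp [coordSum, Finset.sum_ite, sub_eq_add_neg]
    omega
  obtain ⟨t, ht, htc⟩ := Finset.exists_subset_card_eq hcard
  let e := Finset.equivOfCardEq htc.symm
  refine ⟨e.extendSubtype, fun i => ?_⟩
  cases hi : x i
  · have hmem : e.extendSubtype i ∈ t := e.extendSubtype_mem i (by simp [hi])
    have htrue := (Finset.mem_filter.mp (ht hmem)).2
    simp [hi, htrue]
  · simp [hi]

theorem coordSum_comp_perm {n : ℕ} (x : Fin n → Bool) (σ : Equiv.Perm (Fin n)) :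
    coordSum (fun i => x (σ i)) = coordSum x :=
  Equiv.sum_comp σ fun i => if x i then (1 : ℤ) else -1

/-- The symmetrization of a monotone odd function is nonnegative at points with nonnegative
coordinate sum. -/
theorem sum_perm_nonneg {n : ℕ} {f : (Fin n → Bool) → ℝ} (hmono : Monotone f)
    (hodd : ∀ x : Fin n → Bool, f (fun i => !(x i)) = -f x)
    {x : Fin n → Bool} (hx : 0 ≤ coordSum x) :
    0 ≤ ∑ σ : Equiv.Perm (Fin n), f (fun i => x (σ i)) := by
  obtain ⟨τ, hτ⟩ := exists_perm_not_le hx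
  have hshift : ∑ σ : Equiv.Perm (Fin n), f (fun i => x (τ (σ i)))
      = ∑ σ : Equiv.Perm (Fin n), f (fun i => x (σ i)) :=
    Equiv.sum_comp (Equiv.mulLeft τ) fun σ : Equiv.Perm (Fin n) => f (fun i => x (σ i))
  have hle : ∑ σ : Equiv.Perm (Fin n), -f (fun i => x (σ i))
      ≤ ∑ σ : Equiv.Perm (Fin n), f (fun i => x (τ (σ i))) := by
    refine Finset.sum_le_sum fun σ _ => ?_
    rw [← hodd]
    exact hmono fun i => hτ (σ i)
  rw [Finset.sum_neg_distrib] at hle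
  linarith

/-- A monotone odd function has nonnegative sum over any set of points determined by a condition
on the coordinate sum that forces it to be nonnegative. -/
theorem sum_filter_coordSum_nonneg {n : ℕ} {f : (Fin n → Bool) → ℝ} (hmono : Monotone f)
    (hodd : ∀ x : Fin n → Bool, f (fun i => !(x i)) = -f x)
    (p : ℤ → Prop) [DecidablePred p] (hp : ∀ m, p m → 0 ≤ m) :
    0 ≤ ∑ x ∈ Finset.univ.filter (fun x : Fin n → Bool => p (coordSum x)), f x := by
  have hinv (σ : Equiv.Perm (Fin n)) :
      ∑ x ∈ Finset.univ.filter (fun x : Fin n → Bool => p (coordSum x)), f (fun i => x (σ i))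
        = ∑ x ∈ Finset.univ.filter (fun x : Fin n → Bool => p (coordSum x)), f x := by
    refine Finset.sum_equiv (σ.symm.arrowCongr (Equiv.refl Bool)) (fun x => ?_) (fun x _ => rfl)
    have h : coordSum (σ.symm.arrowCongr (Equiv.refl Bool) x) = coordSum x :=
      coordSum_comp_perm x σ
    simp only [Finset.mem_filter, Finset.mem_univ, true_and, h]
  have hsum : 0 ≤ ∑ σ : Equiv.Perm (Fin n),
      ∑ x ∈ Finset.univ.filter (fun x : Fin n → Bool => p (coordSum x)), f (fun i => x (σ i)) := by
    rw [Finset.sum_comm]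
    exact Finset.sum_nonneg fun x hx =>
      sum_perm_nonneg hmono hodd (hp _ (Finset.mem_filter.mp hx).2)
  simp only [hinv, Finset.sum_const, nsmul_eq_mul] at hsum
  exact nonneg_of_mul_nonneg_right hsum (by exact_mod_cast Finset.card_pos.mpr ⟨1, mem_univ _⟩)

/-- **Positive bias of monotone odd functions on upper slices.** Let `f : {-1,1}^n → {-1,1}` be
monotone and odd (`f(−x) = −f(x)`).  Then for every integer `k ≥ 1`:
(i) `Σ_{x : x₁+⋯+xₙ = k} f(x) ≥ 0` (i.e. at least half of the strings on the slice satisfy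
`f(x) = 1`), and (ii) `Σ_{x : x₁+⋯+xₙ ≥ k} f(x) ≥ 0`. -/
theorem stmt18 (n : ℕ) (f : (Fin n → Bool) → ℝ)
    (hf : IsBooleanValued f) (hmono : Monotone f)
    (hodd : ∀ x : Fin n → Bool, f (fun i => !(x i)) = -f x)
    (k : ℤ) (hk : 1 ≤ k) :
    0 ≤ ∑ x ∈ Finset.univ.filter (fun x : Fin n → Bool => coordSum x = k), f x ∧
    0 ≤ ∑ x ∈ Finset.univ.filter (fun x : Fin n → Bool => k ≤ coordSum x), f x := by
  exact ⟨sum_filter_coordSum_nonneg hmono hodd (fun m => m = k) (fun m hm => by omega),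
    sum_filter_coordSum_nonneg hmono hodd (fun m => k ≤ m) (fun m hm => by omega)⟩
end
end

section
/- Fix n ≥ 1 and a real t ≥ 0, and define f_t : {-1,1}^n → {-1,0,1} by f_t(x) = 1 if x₁+⋯+xₙ > t√n, f_t(x) = −1 if x₁+⋯+xₙ < −t√n, and f_t(x) = 0 otherwise. Then for every function h : {-1,1}^n → [-1,1] with Pr_x[h(x) ≠ 0] ≤ Pr_x[f_t(x) ≠ 0], one has Σ_{i=1}^n ĥ({i}) ≤ Σ_{i=1}^n f̂_t({i}), where x is uniform on {-1,1}^n. -/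
open Finset

noncomputable section

/-- The symmetric threshold function `f_t : {-1,1}^n → {-1,0,1}`: it is `1` if
`x₁+⋯+xₙ > t√n`, `-1` if `x₁+⋯+xₙ < −t√n`, and `0` otherwise. -/
def fthr (n : ℕ) (t : ℝ) (x : Fin n → Bool) : ℝ :=
  if t * Real.sqrt n < (coordSum x : ℝ) then 1
  else if (coordSum x : ℝ) < -(t * Real.sqrt n) then -1
  else 0

theorem sum_fcoef_singleton {n : ℕ} (g : (Fin n → Bool) → ℝ) :
    ∑ i : Fin n, fcoef g {i} = expect (fun x => g x * (coordSum x : ℝ)) := by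
  simp only [fcoef, _root_.expect, Finset.prod_singleton, ← Finset.sum_div]
  rw [Finset.sum_comm]
  simp [coordSum, sgn, Finset.mul_sum]

/-- The penalized objective `g · s - τ · 1[g ≠ 0]`, with `τ = t√n`, is maximized pointwise by the
symmetric threshold function. -/
theorem mul_coordSum_sub_le_fthr {n : ℕ} {t : ℝ} (ht : 0 ≤ t) (x : Fin n → Bool) {a : ℝ}
    (ha : |a| ≤ 1) :
    a * (coordSum x : ℝ) - t * √n * (if a = 0 then 0 else 1) ≤
      fthr n t x * (coordSum x : ℝ) - t * √n * (if fthr n t x = 0 then 0 else 1) := by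
  have hτ : 0 ≤ t * √n := by positivity
  have has : a * (coordSum x : ℝ) ≤ |(coordSum x : ℝ)| :=
    (le_abs_self _).trans <| by
      rw [abs_mul]
      exact mul_le_of_le_one_left (abs_nonneg _) ha
  unfold fthr
  generalize (coordSum x : ℝ) = s at *
  generalize t * √n = τ at *
  rcases eq_or_ne a 0 with rfl | h0
  · split_ifs <;> simp_all <;> linarith
  · rcases abs_cases s with ⟨hs, _⟩ | ⟨hs, _⟩ <;> rw [hs] at has <;> simp only [if_neg h0] <;>
      split_ifs <;> first | linarith | simp_all

/-- **The symmetric threshold function maximizes the level-1 Fourier mass among functions of at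
most its support size.** For `n ≥ 1`, `t ≥ 0` and every `h : {-1,1}^n → [-1,1]` with
`Pr_x[h(x) ≠ 0] ≤ Pr_x[f_t(x) ≠ 0]`, one has `Σᵢ ĥ({i}) ≤ Σᵢ f̂_t({i})`. -/
theorem stmt19 (n : ℕ) (hn : 1 ≤ n) (t : ℝ) (ht : 0 ≤ t)
    (h : (Fin n → Bool) → ℝ) (hb : IsBounded h)
    (hsupp : expect (fun x => if h x = 0 then (0 : ℝ) else 1) ≤
      expect (fun x => if fthr n t x = 0 then (0 : ℝ) else 1)) :
    (∑ i : Fin n, fcoef h {i}) ≤ ∑ i : Fin n, fcoef (fthr n t) {i} := by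
  rw [sum_fcoef_singleton, sum_fcoef_singleton]
  unfold _root_.expect at *
  have hpow : (0 : ℝ) < 2 ^ Fintype.card (Fin n) := by positivity
  rw [div_le_div_iff_of_pos_right hpow] at hsupp ⊢
  have hsum := Finset.sum_le_sum fun x (_ : x ∈ (univ : Finset (Fin n → Bool))) =>
    mul_coordSum_sub_le_fthr ht x (hb x)
  simp only [Finset.sum_sub_distrib, ← Finset.mul_sum] at hsum
  have hpenalty := mul_le_mul_of_nonneg_left hsupp (show 0 ≤ t * √n by positivity)
  linarith
end
end
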